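/- arXiv:2506.04407 — 2 statements merged into one kernel-verified Lean document; each statement's English description precedes it below -/
import Mathlib

section
/- Let k ≥ 2 and let x_k = π(u_k) be the Thue-Morse-like binary sequence. Then the first difference of factor complexity of x_k eventually takes only the values 4k−2 and 4k: there exists N₀ ∈ ℕ such that for every N ≥ N₀ one has ΔC(N) ∈ {4k−2, 4k}. -/
open List Filter Topology

/-- The alphabet `A`: the letter `(b, j)` is the unprimed letter `j` if `b = false`
and the primed letter `j′` if `b = true`.  Only letters with `j < k` occur. -/
abbrev Letter : Type := Bool × ℕ

/-- The morphism ξ_k on letters: `0 ↦ 01`, `j ↦ j+1` for `1 ≤ j ≤ k−2`, `k−1 ↦ 0′`,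
and symmetrically on primed letters with `(k−1)′ ↦ 0`. -/
def xiL (k : ℕ) (a : Letter) : List Letter :=
  if a.2 = 0 then [(a.1, 0), (a.1, 1)]
  else if a.2 = k - 1 then [(!a.1, 0)]
  else [(a.1, a.2 + 1)]

/-- The morphism ξ_k on finite words. -/
def xiW (k : ℕ) (w : List Letter) : List Letter := w.flatMap (xiL k)

/-- The word ξ_k^n(0). -/
def xiPow (k n : ℕ) : List Letter := (xiW k)^[n] [((false : Bool), (0 : ℕ))]

/-- The projection π : A → {0,1}, with `false` playing the role of `0` and
`true` the role of `1`. -/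
def proj (a : Letter) : Bool := if a.2 = 0 then a.1 else !a.1

/-- The twin map `ℓ ↔ ℓ′` on letters. -/
def twin (a : Letter) : Letter := (!a.1, a.2)

/-- The finite word `w` occurs in the infinite word `v` at position `j`. -/
def OccursAt {α : Type*} (w : List α) (v : ℕ → α) (j : ℕ) : Prop :=
  ∀ i, i < w.length → w[i]? = some (v (j + i))

/-- The finite word `w` is a prefix of the infinite word `v`. -/
def PrefixSeq {α : Type*} (w : List α) (v : ℕ → α) : Prop := OccursAt w v 0

/-- The finite word `w` is a factor of the infinite word `v`. -/
def FactorOf {α : Type*} (w : List α) (v : ℕ → α) : Prop := ∃ j, OccursAt w v j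

/-- `v` is the fixed point `u_k = ξ_k^ω(0)`: every `ξ_k^n(0)` is a prefix of `v`. -/
def IsFixedPoint (k : ℕ) (v : ℕ → Letter) : Prop := ∀ n, PrefixSeq (xiPow k n) v

/-- `q ≥ 1` is a period of the finite word `z`. -/
def HasPeriod {α : Type*} (z : List α) (q : ℕ) : Prop :=
  1 ≤ q ∧ ∀ i, i + q < z.length → z[i]? = z[i + q]?

/-- `w` is a left special factor of the infinite word `v`. -/
def LeftSpecial {α : Type*} (w : List α) (v : ℕ → α) : Prop :=
  ∃ a b : α, a ≠ b ∧ FactorOf (a :: w) v ∧ FactorOf (b :: w) v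

/-- `w` is a right special factor of the infinite word `v`. -/
def RightSpecial {α : Type*} (w : List α) (v : ℕ → α) : Prop :=
  ∃ a b : α, a ≠ b ∧ FactorOf (w ++ [a]) v ∧ FactorOf (w ++ [b]) v

/-- `w` is a bispecial factor of the infinite word `v`. -/
def Bispecial {α : Type*} (w : List α) (v : ℕ → α) : Prop :=
  LeftSpecial w v ∧ RightSpecial w v

/-- The set of left extensions of `w` in `v`. -/
def Lext {α : Type*} (w : List α) (v : ℕ → α) : Set α := {a | FactorOf (a :: w) v}

/-- The set of right extensions of `w` in `v`. -/
def Rext {α : Type*} (w : List α) (v : ℕ → α) : Set α := {a | FactorOf (w ++ [a]) v}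

/-- `r` is a return word to `w` in `v`: it spans two consecutive occurrences of `w`. -/
def ReturnWordTo {α : Type*} (r w : List α) (v : ℕ → α) : Prop :=
  ∃ j ℓ, j < ℓ ∧ OccursAt w v j ∧ OccursAt w v ℓ ∧
    (∀ m, j < m → m < ℓ → ¬ OccursAt w v m) ∧
    r = (List.range (ℓ - j)).map (fun i => v (j + i))

/-- The factor complexity of an infinite word. -/
noncomputable def complexity {α : Type*} (v : ℕ → α) (n : ℕ) : ℕ :=
  {w : List α | w.length = n ∧ FactorOf w v}.ncard

namespace ThueMorseLike

/-- The first letter of `ξ a`, where `κ = k - 1`. -/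
def firstLetter (κ : ℕ) (a : Letter) : Letter :=
  if a.2 = 0 then a else if a.2 = κ then (!a.1, 0) else (a.1, a.2 + 1)

/-- The last letter of `ξ a`, where `κ = k - 1`. -/
def lastLetter (κ : ℕ) (a : Letter) : Letter :=
  if a.2 = κ then (!a.1, 0) else (a.1, a.2 + 1)

/-- The length of the image under `ξ` of the prefix of `u` of length `i`. -/
def pos (u : ℕ → Letter) : ℕ → ℕ
  | 0 => 0
  | i + 1 => pos u i + if (u i).2 = 0 then 2 else 1

/-- Letterwise description of the fixed point of `ξ` for `k = κ + 1`. -/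
structure XiFixed (κ : ℕ) (u : ℕ → Letter) : Prop where
  one_le : 1 ≤ κ
  zero : u 0 = (false, 0)
  first : ∀ i, u (pos u i) = firstLetter κ (u i)
  last : ∀ i, u (pos u (i + 1) - 1) = lastLetter κ (u i)

section FixedPoint

variable {k : ℕ} {u : ℕ → Letter}

theorem occursAt_append {α : Type*} {w w' : List α} {v : ℕ → α} {j : ℕ}
    (h : OccursAt (w ++ w') v j) : OccursAt w' v (j + w.length) := by
  intro i hi
  have := h (w.length + i) (by simp; omega)
  rw [List.getElem?_append_right (by omega)] at this
  simpa [Nat.add_assoc] using this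

theorem occursAt_prefix {α : Type*} {w w' : List α} {v : ℕ → α} {j : ℕ}
    (hw : w <+: w') (h : OccursAt w' v j) : OccursAt w v j := by
  intro i hi
  rw [← h i (hi.trans_le hw.length_le)]
  obtain ⟨t, rfl⟩ := hw
  rw [List.getElem?_append_left hi]

theorem occursAt_iff {α : Type*} {w : List α} {v : ℕ → α} {j : ℕ} :
    OccursAt w v j ↔ w = (List.range w.length).map fun i => v (j + i) := by
  constructor
  · intro h
    apply List.ext_getElem (by simp)
    intro i h₁ _
    have := h i h₁
    rw [List.getElem?_eq_getElem h₁] at this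
    simpa using this
  · intro h i hi
    rw [h]
    simp [hi]

theorem xiW_append (w w' : List Letter) : xiW k (w ++ w') = xiW k w ++ xiW k w' := by
  simp [xiW]

theorem xiPow_succ (n : ℕ) : xiPow k (n + 1) = xiW k (xiPow k n) := by
  simp [xiPow, Function.iterate_succ_apply']

theorem length_le_length_xiW (w : List Letter) : w.length ≤ (xiW k w).length := by
  induction w with
  | nil => simp
  | cons a w ih =>
    have : 1 ≤ (xiL k a).length := by unfold xiL; split_ifs <;> simp
    have h : xiW k (a :: w) = xiL k a ++ xiW k w := by simp [xiW]
    rw [h]; simp; omega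

theorem xiPow_eq_cons (n : ℕ) :
    ∃ w, xiPow k n = ((false : Bool), (0 : ℕ)) :: w ∧ n ≤ w.length := by
  induction n with
  | zero => exact ⟨[], by simp [xiPow]⟩
  | succ n ih =>
    obtain ⟨w, hw, hn⟩ := ih
    refine ⟨(false, 1) :: xiW k w, ?_, ?_⟩
    · rw [xiPow_succ, hw]; simp [xiW, xiL]
    · have := length_le_length_xiW (k := k) w
      simp; omega

theorem prefixSeq_xiW (hu : IsFixedPoint k u) (m : ℕ) :
    PrefixSeq (xiW k ((List.range m).map u)) u := by
  obtain ⟨w, hw, hm⟩ := xiPow_eq_cons (k := k) m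
  have h₁ := occursAt_iff.1 (hu m)
  have h₂ : (List.range m).map u <+: xiPow k m := by
    rw [h₁]
    have hle : m ≤ (xiPow k m).length := by rw [hw]; simp; omega
    obtain ⟨d, hd⟩ := Nat.exists_eq_add_of_le hle
    rw [hd, List.range_add]
    simp
  obtain ⟨t, ht⟩ := h₂
  have h₃ := hu (m + 1)
  rw [xiPow_succ, ← ht, xiW_append] at h₃
  exact occursAt_prefix (List.prefix_append _ _) h₃

theorem length_xiW_range (m : ℕ) : (xiW k ((List.range m).map u)).length = pos u m := by
  induction m with
  | zero => simp [xiW, pos]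
  | succ m ih =>
    rw [List.range_succ, List.map_append, xiW_append, List.length_append, ih, pos]
    congr 1
    simp only [xiW, xiL, List.map_cons, List.map_nil, List.flatMap_cons, List.flatMap_nil,
      List.append_nil]
    split_ifs <;> simp

theorem occursAt_xiL (hu : IsFixedPoint k u) (m : ℕ) : OccursAt (xiL k (u m)) u (pos u m) := by
  have h := prefixSeq_xiW hu (m + 1)
  rw [List.range_succ, List.map_append, xiW_append] at h
  have h₂ := occursAt_append h
  rw [length_xiW_range] at h₂
  simpa [xiW] using h₂

theorem xiFixed_of_isFixedPoint {κ : ℕ} (hκ : 1 ≤ κ) (hu : IsFixedPoint (κ + 1) u) :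
    XiFixed κ u where
  one_le := hκ
  zero := by
    have := hu 0 0 (by simp [xiPow])
    simpa [xiPow, eq_comm] using this
  first i := by
    have h := occursAt_xiL hu i 0 (by unfold xiL; split_ifs <;> simp)
    rcases hui : u i with ⟨b, j⟩
    rw [hui] at h
    unfold xiL at h
    unfold firstLetter
    simp only [Nat.add_sub_cancel] at h
    simp only
    split_ifs at h ⊢ with h₁ h₂ <;> simp_all
  last i := by
    rcases hui : u i with ⟨b, j⟩
    have h := occursAt_xiL hu i
    rw [hui] at h
    unfold pos lastLetter
    rw [hui]
    unfold xiL at h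
    simp only [Nat.add_sub_cancel] at h ⊢
    split_ifs at h ⊢ with h₁ h₂ h₂
    · omega
    · have := h 1 (by simp)
      simpa [eq_comm, h₁] using this
    · have := h 0 (by simp)
      simpa [eq_comm] using this
    · have := h 0 (by simp)
      simpa [eq_comm] using this

end FixedPoint

/-- The twin map applied `b` times. -/
def tw (b : Bool) (a : Letter) : Letter := (xor b a.1, a.2)

theorem tw_false (a : Letter) : tw false a = a := by simp [tw]

theorem proj_tw (b : Bool) (a : Letter) : proj (tw b a) = xor b (proj a) := by
  unfold proj tw
  split_ifs <;> simp

theorem firstLetter_tw (κ : ℕ) (b : Bool) (a : Letter) :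
    firstLetter κ (tw b a) = tw b (firstLetter κ a) := by
  unfold firstLetter tw
  split_ifs <;> simp_all

theorem lastLetter_tw (κ : ℕ) (b : Bool) (a : Letter) :
    lastLetter κ (tw b a) = tw b (lastLetter κ a) := by
  unfold lastLetter tw
  split_ifs <;> simp_all

theorem iterate_lastLetter_tw (κ : ℕ) (b : Bool) (n : ℕ) (a : Letter) :
    (lastLetter κ)^[n] (tw b a) = tw b ((lastLetter κ)^[n] a) := by
  induction n with
  | zero => rfl
  | succ n ih => rw [Function.iterate_succ_apply', ih, lastLetter_tw, Function.iterate_succ_apply']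

theorem pos_succ (u : ℕ → Letter) (i : ℕ) :
    pos u (i + 1) = pos u i + if (u i).2 = 0 then 2 else 1 := rfl

theorem pos_strictMono (u : ℕ → Letter) : StrictMono (pos u) :=
  strictMono_nat_of_lt_succ fun i => by rw [pos_succ]; split_ifs <;> omega

theorem exists_pos_eq (u : ℕ → Letter) (p : ℕ) :
    ∃ i, p = pos u i ∨ (p = pos u i + 1 ∧ (u i).2 = 0) := by
  induction p with
  | zero => exact ⟨0, Or.inl rfl⟩
  | succ p ih =>
    obtain ⟨i, h | ⟨h, h'⟩⟩ := ih
    · by_cases h0 : (u i).2 = 0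
      · exact ⟨i, Or.inr ⟨by omega, h0⟩⟩
      · exact ⟨i + 1, Or.inl (by rw [pos_succ, if_neg h0, h])⟩
    · exact ⟨i + 1, Or.inl (by rw [pos_succ, if_pos h', h])⟩

namespace XiFixed

variable {κ : ℕ} {u : ℕ → Letter}

theorem pos_one (h : XiFixed κ u) : pos u 1 = 2 := by simp [pos, h.zero]

theorem lt_pos (h : XiFixed κ u) {i : ℕ} (hi : 1 ≤ i) : i < pos u i := by
  induction i, hi using Nat.le_induction with
  | base => rw [h.pos_one]; omega
  | succ i _ ih => have := pos_strictMono u (Nat.lt_succ_self i); simp at this; omega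

theorem pos_add_one (h : XiFixed κ u) {i : ℕ} (hi : (u i).2 = 0) :
    u (pos u i + 1) = ((u i).1, 1) := by
  have h₁ := h.last i
  have := h.one_le
  rw [pos_succ, if_pos hi] at h₁
  simp only [Nat.add_one_sub_one, lastLetter] at h₁
  rw [if_neg (by omega), hi] at h₁
  exact h₁

theorem snd_le (h : XiFixed κ u) (p : ℕ) : (u p).2 ≤ κ := by
  induction p using Nat.strong_induction_on with
  | _ p ih =>
    rcases Nat.eq_zero_or_pos p with rfl | hp
    · simp [h.zero]
    · obtain ⟨i, rfl | ⟨rfl, hi⟩⟩ := exists_pos_eq u p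
      · have hi1 : 1 ≤ i := by
          by_contra hc
          rw [show i = 0 by omega] at hp
          simp [pos] at hp
        have := ih i (h.lt_pos hi1)
        rw [h.first i, firstLetter]
        split_ifs <;> simp <;> omega
      · rw [h.pos_add_one hi]
        exact h.one_le

theorem first_eq_or (h : XiFixed κ u) {i : ℕ} {b : Bool} {j : ℕ} (hp : u (pos u i) = (b, j)) :
    (j = 0 ∧ u i = (b, 0)) ∨ (j = 0 ∧ u i = (!b, κ)) ∨ ∃ l, j = l + 2 ∧ u i = (b, l + 1) := by
  rw [h.first i] at hp
  rcases hui : u i with ⟨c, l⟩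
  rw [hui] at hp
  unfold firstLetter at hp
  simp only at hp
  split_ifs at hp with h₁ h₂
  · simp_all
  · simp only [Prod.mk.injEq] at hp
    obtain ⟨rfl, rfl⟩ := hp
    simp [h₂]
  · simp only [Prod.mk.injEq] at hp
    obtain ⟨rfl, rfl⟩ := hp
    exact Or.inr (Or.inr ⟨l - 1, by omega, by rw [Nat.sub_add_cancel (by omega)]⟩)

/-- Every letter `j + 1` is preceded by the letter `j` of the same sign. -/
theorem pred_of_succ (h : XiFixed κ u) {p : ℕ} {b : Bool} {j : ℕ} (hp : u p = (b, j + 1)) :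
    ∃ q, p = q + 1 ∧ u q = (b, j) := by
  induction p using Nat.strong_induction_on generalizing b j with
  | _ p ih =>
    have hp0 : p ≠ 0 := by intro h0; rw [h0, h.zero] at hp; simp at hp
    obtain ⟨i, rfl | ⟨rfl, hi⟩⟩ := exists_pos_eq u p
    · have hi1 : 1 ≤ i := by
        by_contra hc
        exact hp0 (by rw [show i = 0 by omega]; rfl)
      obtain ⟨h0, -⟩ | ⟨h0, -⟩ | ⟨l, hl, hui⟩ := h.first_eq_or hp
      · omega
      · omega
      · obtain ⟨q, rfl, hq⟩ := ih i (h.lt_pos hi1) hui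
        refine ⟨pos u (q + 1) - 1, by have := h.lt_pos hi1; omega, ?_⟩
        have := h.snd_le (q + 1)
        rw [hui] at this
        simp only at this
        rw [h.last q, hq, lastLetter, if_neg (by simp only; omega)]
        simp only [Prod.mk.injEq, true_and]
        omega
    · rw [h.pos_add_one hi] at hp
      simp only [Prod.mk.injEq] at hp
      refine ⟨pos u i, rfl, ?_⟩
      rw [h.first i, firstLetter, if_pos hi]
      exact Prod.ext hp.1 (by simp only; omega)

/-- A letter `0` that is not followed by `1` is preceded by the last letter of opposite sign. -/
theorem pred_of_zero (h : XiFixed κ u) {p : ℕ} {b : Bool} (hp : u p = (b, 0))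
    (hp' : u (p + 1) ≠ (b, 1)) : ∃ q, p = q + 1 ∧ u q = (!b, κ) := by
  have hκ := h.one_le
  obtain ⟨i, rfl | ⟨rfl, hi⟩⟩ := exists_pos_eq u p
  · obtain ⟨-, hi⟩ | ⟨-, hi⟩ | ⟨l, hl, hi⟩ := h.first_eq_or hp
    · rw [h.pos_add_one (by rw [hi]), hi] at hp'
      exact absurd rfl hp'
    · obtain ⟨q, rfl, hq⟩ := h.pred_of_succ (j := κ - 1) (by rw [hi, Nat.sub_add_cancel hκ])
      refine ⟨pos u (q + 1) - 1, ?_, ?_⟩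
      · have := h.lt_pos (i := q + 1) (by omega); omega
      · rw [h.last q, hq, lastLetter, if_neg (by simp only; omega), Nat.sub_add_cancel hκ]
    · omega
  · rw [h.pos_add_one hi] at hp
    simp at hp

theorem pred_chain (h : XiFixed κ u) {p : ℕ} {b : Bool} {j : ℕ} (hp : u p = (b, j)) :
    ∃ q, p = q + j ∧ ∀ t ≤ j, u (q + t) = (b, t) := by
  induction j generalizing p with
  | zero => exact ⟨p, rfl, fun t ht => by rw [Nat.le_zero.1 ht]; exact hp⟩
  | succ j ih =>
    obtain ⟨r, rfl, hr⟩ := h.pred_of_succ hp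
    obtain ⟨q, rfl, hq⟩ := ih hr
    refine ⟨q, rfl, fun t ht => ?_⟩
    rcases Nat.lt_or_ge j t with hlt | hge
    · rw [show t = j + 1 by omega]; exact hp
    · exact hq t hge

/-- Around a letter `0` not followed by `1`: the preceding letters are `0, 1, …, κ` of opposite
sign. -/
theorem pred_chain_of_zero (h : XiFixed κ u) {p : ℕ} {b : Bool} (hp : u p = (b, 0))
    (hp' : u (p + 1) ≠ (b, 1)) : ∃ q, p = q + κ + 1 ∧ ∀ t ≤ κ, u (q + t) = (!b, t) := by
  obtain ⟨r, rfl, hr⟩ := h.pred_of_zero hp hp'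
  obtain ⟨q, rfl, hq⟩ := h.pred_chain hr
  exact ⟨q, rfl, hq⟩

/-- The letter `j` is followed by `j + 1` of the same sign or by a letter `0`. -/
theorem succ_eq (h : XiFixed κ u) {p : ℕ} {b : Bool} {j : ℕ} (hp : u p = (b, j)) :
    u (p + 1) = (b, j + 1) ∨ ∃ c, u (p + 1) = (c, 0) := by
  rcases hs : u (p + 1) with ⟨c, l⟩
  rcases l with _ | l
  · exact Or.inr ⟨c, rfl⟩
  · obtain ⟨q, hq, hq'⟩ := h.pred_of_succ hs
    rw [← Nat.add_right_cancel hq, hp] at hq'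
    simp only [Prod.mk.injEq] at hq'
    obtain ⟨rfl, rfl⟩ := hq'
    exact Or.inl rfl

end XiFixed

/-- The length of the image under `ξ^n` of the prefix of `u` of length `i`. -/
def level (u : ℕ → Letter) (n i : ℕ) : ℕ := (pos u)^[n] i

/-- The length of `ξ^n(0)`. -/
def F (u : ℕ → Letter) (n : ℕ) : ℕ := level u n 1

section Level

variable (u : ℕ → Letter)

theorem level_zero_left (i : ℕ) : level u 0 i = i := rfl

theorem level_succ (n i : ℕ) : level u (n + 1) i = pos u (level u n i) :=
  Function.iterate_succ_apply' _ _ _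

theorem level_succ' (n i : ℕ) : level u (n + 1) i = level u n (pos u i) :=
  Function.iterate_succ_apply _ _ _

theorem level_add (m n i : ℕ) : level u (m + n) i = level u m (level u n i) :=
  Function.iterate_add_apply _ _ _ _

theorem level_zero (n : ℕ) : level u n 0 = 0 := by
  induction n with
  | zero => rfl
  | succ n ih => rw [level_succ, ih]; rfl

theorem level_strictMono (n : ℕ) : StrictMono (level u n) := (pos_strictMono u).iterate n

theorem level_add_le (n i d : ℕ) : level u n (i + d) ≤ level u n i + d * 2 ^ n := by
  induction n generalizing i d with
  | zero => simp [level_zero_left]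
  | succ n ih =>
    rw [level_succ', level_succ']
    have h₁ : pos u (i + d) ≤ pos u i + 2 * d := by
      induction d with
      | zero => simp
      | succ d ihd =>
        rw [← Nat.add_assoc, pos_succ]
        split_ifs <;> omega
    calc level u n (pos u (i + d)) ≤ level u n (pos u i + 2 * d) :=
          (level_strictMono u n).monotone h₁
      _ ≤ level u n (pos u i) + 2 * d * 2 ^ n := ih _ _
      _ = _ := by ring

end Level

namespace XiFixed

variable {κ : ℕ} {u : ℕ → Letter}

theorem level_first (h : XiFixed κ u) (n i : ℕ) :
    u (level u n i) = (firstLetter κ)^[n] (u i) := by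
  induction n with
  | zero => rfl
  | succ n ih => rw [level_succ, h.first, ih, Function.iterate_succ_apply']

theorem le_level (h : XiFixed κ u) (n : ℕ) {i : ℕ} (hi : 1 ≤ i) : i + n ≤ level u n i := by
  induction n with
  | zero => simp [level_zero_left]
  | succ n ih =>
    have := h.lt_pos (i := level u n i) (by omega)
    rw [level_succ]; omega

theorem level_last (h : XiFixed κ u) (n i : ℕ) :
    u (level u n (i + 1) - 1) = (lastLetter κ)^[n] (u i) := by
  induction n with
  | zero => rfl
  | succ n ih =>
    have := h.le_level n (i := i + 1) (by omega)
    obtain ⟨q, hq⟩ : ∃ q, level u n (i + 1) = q + 1 := ⟨level u n (i + 1) - 1, by omega⟩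
    rw [level_succ, hq, h.last, Function.iterate_succ_apply', ← ih, hq, Nat.add_sub_cancel]

theorem pos_agree (h : XiFixed κ u) {b : Bool} {p q m : ℕ}
    (hpq : ∀ t < m, u (p + t) = tw b (u (q + t))) :
    ∃ d, m ≤ d ∧ pos u (p + m) = pos u p + d ∧ pos u (q + m) = pos u q + d ∧
      ∀ t < d, u (pos u p + t) = tw b (u (pos u q + t)) := by
  induction m with
  | zero => exact ⟨0, by simp⟩
  | succ m ih =>
    obtain ⟨d, hd, hp, hq, hd'⟩ := ih fun t ht => hpq t (by omega)
    have hm := hpq m (by omega)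
    have hfst : u (pos u p + d) = tw b (u (pos u q + d)) := by
      rw [← hp, ← hq, h.first, h.first, hm, firstLetter_tw]
    have hsnd : (u (p + m)).2 = (u (q + m)).2 := by rw [hm]; rfl
    by_cases h0 : (u (q + m)).2 = 0
    · refine ⟨d + 2, by omega, ?_, ?_, fun t ht => ?_⟩
      · rw [← Nat.add_assoc, pos_succ, hsnd, if_pos h0, hp, Nat.add_assoc]
      · rw [← Nat.add_assoc, pos_succ, if_pos h0, hq, Nat.add_assoc]
      · rcases (show t < d ∨ t = d ∨ t = d + 1 by omega) with ht | rfl | rfl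
        · exact hd' t ht
        · exact hfst
        · have h₁ := h.pos_add_one h0
          have h₂ := h.pos_add_one (hsnd.trans h0)
          rw [hp] at h₂
          rw [hq] at h₁
          rw [← Nat.add_assoc, ← Nat.add_assoc, h₁, h₂, hm]
          rfl
    · refine ⟨d + 1, by omega, ?_, ?_, fun t ht => ?_⟩
      · rw [← Nat.add_assoc, pos_succ, hsnd, if_neg h0, hp, Nat.add_assoc]
      · rw [← Nat.add_assoc, pos_succ, if_neg h0, hq, Nat.add_assoc]
      · rcases (show t < d ∨ t = d by omega) with ht | rfl
        · exact hd' t ht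
        · exact hfst

theorem level_agree (h : XiFixed κ u) (n : ℕ) {b : Bool} {p q m : ℕ}
    (hpq : ∀ t < m, u (p + t) = tw b (u (q + t))) :
    ∃ d, m ≤ d ∧ level u n (p + m) = level u n p + d ∧ level u n (q + m) = level u n q + d ∧
      ∀ t < d, u (level u n p + t) = tw b (u (level u n q + t)) := by
  induction n with
  | zero => exact ⟨m, le_rfl, rfl, rfl, hpq⟩
  | succ n ih =>
    obtain ⟨d, hd, hp, hq, hd'⟩ := ih
    obtain ⟨e, he, hp', hq', he'⟩ := h.pos_agree hd'
    refine ⟨e, hd.trans he, ?_, ?_, ?_⟩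
    · rw [level_succ, level_succ, hp, hp']
    · rw [level_succ, level_succ, hq, hq']
    · rwa [level_succ, level_succ]

theorem level_block (h : XiFixed κ u) (n : ℕ) {b : Bool} {p m : ℕ}
    (hp : ∀ t < m, u (p + t) = tw b (u t)) :
    level u n (p + m) = level u n p + level u n m ∧
      ∀ t < level u n m, u (level u n p + t) = tw b (u t) := by
  obtain ⟨d, -, h₁, h₂, h₃⟩ := h.level_agree n (q := 0) (by simpa using hp)
  rw [level_zero, Nat.zero_add, Nat.zero_add] at h₂
  subst h₂
  simp only [level_zero, Nat.zero_add] at h₃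
  exact ⟨h₁, h₃⟩

theorem F_succ_eq (h : XiFixed κ u) (n : ℕ) : F u (n + 1) = level u n 2 := by
  rw [F, level_succ', h.pos_one]

theorem F_strictMono (h : XiFixed κ u) : StrictMono (F u) :=
  strictMono_nat_of_lt_succ fun n => by
    rw [h.F_succ_eq, F]; exact level_strictMono u n (by omega)

theorem lt_F (h : XiFixed κ u) (n : ℕ) : n < F u n := by
  have := h.le_level n (i := 1) le_rfl
  rw [F]; omega

theorem one (h : XiFixed κ u) : u 1 = (false, 1) := by
  have := h.pos_add_one (i := 0) (by rw [h.zero])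
  rwa [h.zero] at this

theorem block_one (h : XiFixed κ u) (n : ℕ) {b : Bool} {p : ℕ} (hp : u p = (b, 0)) :
    level u n (p + 1) = level u n p + F u n ∧
      ∀ t < F u n, u (level u n p + t) = tw b (u t) := by
  refine h.level_block n (m := 1) fun t ht => ?_
  rw [show t = 0 by omega, Nat.add_zero, hp, h.zero]
  simp [tw]

theorem block_two (h : XiFixed κ u) (n : ℕ) {b : Bool} {p : ℕ} (hp : u p = (b, 0))
    (hp' : u (p + 1) = (b, 1)) :
    level u n (p + 2) = level u n p + F u (n + 1) ∧
      ∀ t < F u (n + 1), u (level u n p + t) = tw b (u t) := by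
  rw [h.F_succ_eq]
  refine h.level_block n (m := 2) fun t ht => ?_
  rcases (show t = 0 ∨ t = 1 by omega) with rfl | rfl
  · rw [Nat.add_zero, hp, h.zero]; simp [tw]
  · rw [hp', h.one]; simp [tw]

theorem pos_start (h : XiFixed κ u) {j : ℕ} (hj : j ≤ κ) :
    u j = (false, j) ∧ pos u (j + 1) = j + 2 := by
  induction j with
  | zero => exact ⟨h.zero, h.pos_one⟩
  | succ j ih =>
    obtain ⟨h₁, h₂⟩ := ih (by omega)
    have hu : u (j + 1) = (false, j + 1) := by
      rcases Nat.eq_zero_or_pos j with rfl | hj0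
      · exact h.one
      · have hp : pos u j = j + 1 := by rw [pos_succ, h₁, if_neg (by simp; omega)] at h₂; omega
        rw [← hp, h.first, h₁, firstLetter, if_neg (by simp; omega), if_neg (by simp; omega), hp]
    refine ⟨hu, ?_⟩
    rw [pos_succ, h₂, hu, if_neg (by simp)]

theorem start (h : XiFixed κ u) {j : ℕ} (hj : j ≤ κ) : u j = (false, j) := (h.pos_start hj).1

theorem start_kappa_add_one (h : XiFixed κ u) : u (κ + 1) = (true, 0) := by
  have hκ := h.one_le
  have hp : pos u κ = κ + 1 := by
    have := (h.pos_start (j := κ - 1) (by omega)).2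
    rwa [show κ - 1 + 1 = κ by omega, show κ - 1 + 2 = κ + 1 by omega] at this
  rw [← hp, h.first, h.start le_rfl, firstLetter, if_neg (by simp; omega), if_pos (by simp)]
  rfl

theorem start_kappa_add_two (h : XiFixed κ u) : u (κ + 2) = (true, 0) := by
  rw [← (h.pos_start le_rfl).2, h.first, h.start_kappa_add_one]
  simp [firstLetter]

theorem F_of_le (h : XiFixed κ u) {j : ℕ} (hj : j ≤ κ + 1) : F u j = j + 1 := by
  induction j with
  | zero => rfl
  | succ j ih =>
    rw [F, level_succ, ← F, ih (by omega), (h.pos_start (by omega)).2]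

/-- `ξ^(m+κ+1)(0) = ξ^(m+κ)(0) ξ^m(0′)`. -/
theorem F_add (h : XiFixed κ u) (m : ℕ) :
    F u (m + κ + 1) = F u (m + κ) + F u m ∧
      ∀ t < F u m, u (F u (m + κ) + t) = tw true (u t) := by
  have h₁ : level u m (κ + 1) = F u (m + κ) := by
    rw [F, level_add, ← F, h.F_of_le (by omega)]
  have h₂ : level u m (κ + 1 + 1) = F u (m + κ + 1) := by
    rw [show m + κ + 1 = m + (κ + 1) by omega, F, level_add, ← F, h.F_of_le (by omega)]
  rw [← h₁, ← h₂]
  exact h.block_one m h.start_kappa_add_one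

theorem apply_F (h : XiFixed κ u) (m : ℕ) : u (F u (m + κ)) = (true, 0) := by
  have := (h.F_add m).2 0 (by have := h.lt_F m; omega)
  simpa [h.zero, tw] using this

theorem iterate_firstLetter_zero (κ n : ℕ) (b : Bool) :
    (firstLetter κ)^[n] (b, 0) = (b, 0) := by
  induction n with
  | zero => rfl
  | succ n ih => rw [Function.iterate_succ_apply', ih]; simp [firstLetter]

theorem iterate_firstLetter {κ n j : ℕ} (b : Bool) (hj : 1 ≤ j) (hj' : j ≤ κ) (hn : κ ≤ n) :
    (firstLetter κ)^[n] (b, j) = (!b, 0) := by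
  suffices ∀ d, ∀ j, 1 ≤ j → j + d = κ → ∀ n, d < n → (firstLetter κ)^[n] (b, j) = (!b, 0) from
    this (κ - j) j hj (by omega) n (by omega)
  intro d
  induction d with
  | zero =>
    intro j hj hd n hn
    obtain ⟨n, rfl⟩ : ∃ m, n = m + 1 := ⟨n - 1, by omega⟩
    rw [Function.iterate_succ_apply, firstLetter, if_neg (by simp; omega),
      if_pos (by simpa using hd), iterate_firstLetter_zero]
  | succ d ih =>
    intro j hj hd n hn
    obtain ⟨n, rfl⟩ : ∃ m, n = m + 1 := ⟨n - 1, by omega⟩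
    rw [Function.iterate_succ_apply, firstLetter, if_neg (by simp; omega),
      if_neg (by simp; omega)]
    exact ih (j + 1) (by omega) (by omega) n (by omega)

end XiFixed

/-- The word that continues the bispecial prefix of length `F (q + 2κ + 1)` of `u` by another
prefix of `u`. -/
def branch (κ : ℕ) (u : ℕ → Letter) (q t : ℕ) : Letter :=
  if t < F u (q + 2 * κ + 1) then u t else u (t - F u (q + 2 * κ + 1))

namespace XiFixed

variable {κ : ℕ} {u : ℕ → Letter}

theorem preimage_zero_one (h : XiFixed κ u) {i : ℕ} {b : Bool} (hi : u (i + 1) = (b, 0))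
    (hi' : u (i + 2) = (b, 1)) :
    ∃ i', i' < i ∧ i + 1 = pos u (i' + 1) ∧ u (i' + 1) = (b, 0) := by
  obtain ⟨r, hr | ⟨hr, hr0⟩⟩ := exists_pos_eq u (i + 1)
  · have hr1 : 1 ≤ r := by
      by_contra hc
      rw [show r = 0 by omega, pos] at hr
      omega
    obtain ⟨r, rfl⟩ : ∃ s, r = s + 1 := ⟨r - 1, by omega⟩
    have := h.lt_pos hr1
    refine ⟨r, by omega, hr, ?_⟩
    rw [hr] at hi
    obtain ⟨-, hi₀⟩ | ⟨-, hi₀⟩ | ⟨l, hl, -⟩ := h.first_eq_or hi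
    · exact hi₀
    · exfalso
      have hs := pos_succ u (r + 1)
      have hκ := h.one_le
      rw [hi₀, if_neg (by simp; omega), ← hr] at hs
      have hs' : u (pos u (r + 1 + 1)) = (b, 1) := by rw [hs]; exact hi'
      obtain ⟨h0, -⟩ | ⟨h0, -⟩ | ⟨l, h0, -⟩ := h.first_eq_or hs' <;> omega
    · omega
  · rw [hr, h.pos_add_one hr0] at hi
    simp at hi

theorem pred_of_zero_one_zero (h : XiFixed κ u) {j : ℕ} {b : Bool} (hj₁ : u (j + 1) = (b, 0))
    (hj₂ : u (j + 2) = (b, 1)) (hj₃ : u (j + 3) = (b, 0)) : u j = (b, 0) := by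
  have hκ := h.one_le
  obtain ⟨r, -, hr, hr'⟩ := h.preimage_zero_one hj₁ hj₂
  have hs : pos u (r + 2) = j + 3 := by rw [pos_succ, hr', if_pos rfl, ← hr]
  rw [← hs] at hj₃
  have hl := h.last r
  rw [← hr, Nat.add_sub_cancel] at hl
  obtain ⟨-, hc⟩ | ⟨-, hc⟩ | ⟨l, hc, -⟩ := h.first_eq_or hj₃
  · obtain ⟨s, hs, hs'⟩ := h.pred_of_zero hr' (by rw [hc]; simp)
    rw [hl, Nat.add_right_cancel hs, hs']
    simp [lastLetter]
  · obtain ⟨s, hs, hs'⟩ := h.pred_of_succ (j := κ - 1) (by rw [hc, Nat.sub_add_cancel hκ])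
    obtain rfl : s = r + 1 := by omega
    rw [hr'] at hs'
    simp at hs'
  · omega

/-- Two occurrences of a letter with distinct predecessors desubstitute, unless their right
neighbours differ. -/
theorem desubstitute_step (h : XiFixed κ u) {i j : ℕ} (hl : u i ≠ u j)
    (h₀ : u (i + 1) = u (j + 1)) (h₁ : u (i + 2) = u (j + 2)) :
    ∃ i' j', i' < i ∧ i + 1 = pos u (i' + 1) ∧ j + 1 = pos u (j' + 1) ∧ u i' ≠ u j' ∧
      u (i' + 1) = u (j' + 1) := by
  rcases hi : u (i + 1) with ⟨b, l⟩
  have hj : u (j + 1) = (b, l) := h₀ ▸ hi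
  rcases l with _ | l
  · by_cases h1 : u (i + 2) = (b, 1)
    · obtain ⟨i', hlt, hi₁, hi₂⟩ := h.preimage_zero_one hi h1
      obtain ⟨j', -, hj₁, hj₂⟩ := h.preimage_zero_one hj (h₁ ▸ h1)
      refine ⟨i', j', hlt, hi₁, hj₁, fun hc => hl ?_, hi₂.trans hj₂.symm⟩
      have e₁ := h.last i'
      have e₂ := h.last j'
      rw [← hi₁, Nat.add_sub_cancel] at e₁
      rw [← hj₁, Nat.add_sub_cancel] at e₂
      rw [e₁, e₂, hc]
    · obtain ⟨r, hr, hr'⟩ := h.pred_of_zero hi h1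
      obtain ⟨s, hs, hs'⟩ := h.pred_of_zero hj (h₁ ▸ h1)
      rw [← Nat.add_right_cancel hr] at hr'
      rw [← Nat.add_right_cancel hs] at hs'
      exact absurd (hr'.trans hs'.symm) hl
  · obtain ⟨r, hr, hr'⟩ := h.pred_of_succ hi
    obtain ⟨s, hs, hs'⟩ := h.pred_of_succ hj
    rw [← Nat.add_right_cancel hr] at hr'
    rw [← Nat.add_right_cancel hs] at hs'
    exact absurd (hr'.trans hs'.symm) hl

theorem desubstitute (h : XiFixed κ u) {i j : ℕ} (hl : u i ≠ u j) (h₀ : u (i + 1) = u (j + 1)) :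
    ∃ n i' j', i + 1 = level u n (i' + 1) ∧ j + 1 = level u n (j' + 1) ∧ u i' ≠ u j' ∧
      u (i' + 1) = u (j' + 1) ∧ u (i' + 2) ≠ u (j' + 2) := by
  induction i using Nat.strong_induction_on generalizing j with
  | _ i ih =>
    by_cases h₁ : u (i + 2) = u (j + 2)
    · obtain ⟨i', j', hlt, hi, hj, hl', h₀'⟩ := h.desubstitute_step hl h₀ h₁
      obtain ⟨n, r, s, hr, hs, hrs⟩ := ih i' hlt hl' h₀'
      refine ⟨n + 1, r, s, ?_, ?_, hrs⟩
      · rw [level_succ, ← hr, hi]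
      · rw [level_succ, ← hs, hj]
    · exact ⟨0, i, j, rfl, rfl, hl, h₀, h₁⟩

theorem base_pair (h : XiFixed κ u) {i j : ℕ} (hl : u i ≠ u j) (h₀ : u (i + 1) = u (j + 1))
    (h₁ : u (i + 2) ≠ u (j + 2)) :
    ∃ b, u (i + 1) = (b, 0) ∧ u (j + 1) = (b, 0) ∧
      ((u (i + 2) ≠ (b, 1) ∧ u (j + 2) = (b, 1)) ∨
        (u (j + 2) ≠ (b, 1) ∧ u (i + 2) = (b, 1))) := by
  rcases hi : u (i + 1) with ⟨b, l⟩
  have hj : u (j + 1) = (b, l) := h₀ ▸ hi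
  rcases l with _ | l
  · refine ⟨b, rfl, hj, ?_⟩
    by_cases hi1 : u (i + 2) = (b, 1)
    · exact Or.inr ⟨fun hc => h₁ (hi1.trans hc.symm), hi1⟩
    · by_cases hj1 : u (j + 2) = (b, 1)
      · exact Or.inl ⟨hi1, hj1⟩
      · obtain ⟨r, hr, hr'⟩ := h.pred_of_zero hi hi1
        obtain ⟨s, hs, hs'⟩ := h.pred_of_zero hj hj1
        rw [← Nat.add_right_cancel hr] at hr'
        rw [← Nat.add_right_cancel hs] at hs'
        exact absurd (hr'.trans hs'.symm) hl
  · obtain ⟨r, hr, hr'⟩ := h.pred_of_succ hi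
    obtain ⟨s, hs, hs'⟩ := h.pred_of_succ hj
    rw [← Nat.add_right_cancel hr] at hr'
    rw [← Nat.add_right_cancel hs] at hs'
    exact absurd (hr'.trans hs'.symm) hl

/-- In `001…`, `010′…`, `012…` and their twins, the letters after `0` determine the position where
the images under `ξ^n` cease to agree. -/
theorem dichotomy (h : XiFixed κ u) {b : Bool} {i j q : ℕ} (hq : κ ≤ q)
    (hi : u (i + 1) = (b, 0)) (hi' : u (i + 2) ≠ (b, 1))
    (hj : u (j + 1) = (b, 0)) (hj' : u (j + 2) = (b, 1)) :
    ∃ M ≤ 2 * F u (q + 2 * κ + 1),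
      (∃ c, u (level u (q + 2 * κ) (i + 1) + M) = (c, 0) ∧
        u (level u (q + 2 * κ) (j + 1) + M) = (!c, 0)) ∧
      ((∀ t < M, u (level u (q + 2 * κ) (j + 1) + t) = tw b (u t)) ∨
        (u i = (!b, κ) ∧ u j = (b, 0) ∧ M = F u (q + 2 * κ + 1) + F u q ∧
          ∀ t < M, u (level u (q + 2 * κ) (j + 1) + t) = tw b (branch κ u q t))) := by
  have hκ := h.one_le
  set n := q + 2 * κ with hn
  have hFn : F u n ≤ F u (n + 1) := h.F_strictMono.monotone (by omega)
  have hFq : F u q ≤ F u (n + 1) := h.F_strictMono.monotone (by omega)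
  obtain ⟨hjlen, hjblock⟩ := h.block_two n hj hj'
  have hil : u i = (!b, κ) := by
    obtain ⟨r, hr, hr'⟩ := h.pred_of_zero hi hi'
    rwa [← Nat.add_right_cancel hr] at hr'
  obtain ⟨hilen, -⟩ := h.block_one n hi
  obtain ⟨e, he⟩ : ∃ e, u (i + 2) = (e, 0) := by
    obtain hc | hc := h.succ_eq hi
    · exact absurd hc hi'
    · exact hc
  have he' : u (i + 3) = (e, 1) := by
    by_contra hc
    obtain ⟨r, hr, hr'⟩ := h.pred_of_zero he hc
    obtain rfl : r = i + 1 := by omega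
    rw [hi] at hr'
    simp only [Prod.mk.injEq] at hr'
    omega
  obtain ⟨-, hiblock⟩ := h.block_two n he he'
  have hilen' : level u n (i + 2) = level u n (i + 1) + F u n := hilen
  rw [hilen'] at hiblock
  by_cases heb : e = b
  · subst heb
    refine ⟨F u n, by omega, ⟨e, ?_, ?_⟩, Or.inl fun t ht => hjblock t (by omega)⟩
    · have := hiblock 0 (by have := h.lt_F (n + 1); omega)
      simpa [h.zero, tw] using this
    · rw [hjblock _ (h.F_strictMono (by omega)), show n = q + κ + κ by omega, h.apply_F]
      simp [tw]
  · obtain rfl : e = !b := by cases e <;> cases b <;> simp_all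
    have hF₁ : F u (n + 1) = F u n + F u (q + κ) := by
      have := (h.F_add (q + κ)).1
      rwa [show q + κ + κ = n by omega] at this
    have hF₂ := h.F_add q
    have hF₃ : F u (q + κ + 1) < F u (n + 1) := h.F_strictMono (by omega)
    have hq1 : u (level u n (i + 1) + F u (n + 1)) = (b, 0) := by
      rw [hF₁, ← Nat.add_assoc, hiblock _ (by omega), h.apply_F]
      simp [tw]
    have hq2 : u (level u n (i + 1) + (F u (n + 1) + F u q)) = (b, 0) := by
      rw [show level u n (i + 1) + (F u (n + 1) + F u q) =
        level u n (i + 1) + F u n + F u (q + κ + 1) by omega, hiblock _ hF₃,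
        show q + κ + 1 = q + 1 + κ by omega, h.apply_F]
      simp [tw]
    have hjlen' : level u n (j + 3) = level u n (j + 1) + F u (n + 1) := hjlen
    have main : u (level u n (j + 3)) = (!b, 0) → ∃ M ≤ 2 * F u (n + 1),
        (∃ c, u (level u n (i + 1) + M) = (c, 0) ∧ u (level u n (j + 1) + M) = (!c, 0)) ∧
        ∀ t < M, u (level u n (j + 1) + t) = tw b (u t) := fun hm =>
      ⟨F u (n + 1), by omega, ⟨b, hq1, by rw [← hjlen', hm]⟩, hjblock⟩
    obtain hg | ⟨g, hg⟩ := h.succ_eq hj'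
    · have h2 : 2 ≤ κ := by have := h.snd_le (j + 3); rw [hg] at this; exact this
      obtain ⟨M, hM, hc, ht⟩ := main (by
        rw [h.level_first, hg, iterate_firstLetter b (by omega) (by omega) (by omega)])
      exact ⟨M, hM, hc, Or.inl ht⟩
    · by_cases hgb : g = b
      · subst hgb
        have hg' : u (j + 4) = (g, 1) := by
          by_contra hc
          obtain ⟨r, hr, hr'⟩ := h.pred_of_zero hg hc
          obtain rfl : r = j + 2 := by omega
          rw [hj'] at hr'
          simp at hr'
        obtain ⟨-, hkblock⟩ := h.block_two n hg hg'
        rw [show j + 2 + 1 = j + 3 from rfl, hjlen'] at hkblock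
        refine ⟨F u (n + 1) + F u q, by omega, ⟨g, hq2, ?_⟩, Or.inr ⟨hil, ?_, rfl, ?_⟩⟩
        · rw [← Nat.add_assoc, hkblock _ (h.F_strictMono (by omega)),
            show q = q - κ + κ by omega, h.apply_F]
          simp [tw]
        · exact h.pred_of_zero_one_zero hj hj' hg
        · intro t ht
          rw [branch]
          split_ifs with hlt
          · exact hjblock t hlt
          · rw [← hn] at hlt ⊢
            obtain ⟨d, rfl⟩ := Nat.exists_eq_add_of_le (not_lt.1 hlt)
            rw [← Nat.add_assoc, Nat.add_sub_cancel_left]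
            exact hkblock d (by omega)
      · obtain rfl : g = !b := by cases g <;> cases b <;> simp_all
        obtain ⟨M, hM, hc, ht⟩ := main (by
          rw [h.level_first, hg, iterate_firstLetter_zero])
        exact ⟨M, hM, hc, Or.inl ht⟩

end XiFixed

/-- The length of the run of `π(u)` that ends with the letter `c`, if `c` is followed by a
letter `0`. -/
def runLength (κ : ℕ) (c : Letter) : ℕ := if c.2 = 0 then κ + 1 else c.2

/-- The length of the longest common suffix of the projections of two left contexts ending with
`c` and `d`. -/
def shift (κ : ℕ) (c d : Letter) : ℕ :=
  if proj c = proj d then min (runLength κ c) (runLength κ d) else 0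

theorem shift_tw (κ : ℕ) (b : Bool) (c d : Letter) :
    shift κ (tw b c) (tw b d) = shift κ c d := by
  simp only [shift, proj_tw, Bool.xor_right_inj]
  rfl

theorem shift_comm (κ : ℕ) (c d : Letter) : shift κ c d = shift κ d c := by
  simp only [shift, eq_comm (a := proj c), min_comm]

theorem exists_last_of_not {P : ℕ → Prop} {p : ℕ} (h₀ : P 0) (hp : ¬ P p) :
    ∃ s < p, P s ∧ ∀ t, s < t → t ≤ p → ¬ P t := by
  induction p with
  | zero => exact absurd h₀ hp
  | succ p ih =>
    by_cases hP : P p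
    · exact ⟨p, by omega, hP, fun t h₁ h₂ => by rwa [show t = p + 1 by omega]⟩
    · obtain ⟨s, hs, hs', ht⟩ := ih hP
      refine ⟨s, by omega, hs', fun t h₁ h₂ => ?_⟩
      rcases (show t ≤ p ∨ t = p + 1 by omega) with h₃ | rfl
      · exact ht t h₁ h₃
      · exact hp

namespace XiFixed

variable {κ : ℕ} {u : ℕ → Letter}

theorem run_before_zero (h : XiFixed κ u) {p : ℕ} (hp : (u (p + 1)).2 = 0) :
    ∃ r, p = r + runLength κ (u p) ∧ proj (u r) = !proj (u p) ∧
      ∀ t, 1 ≤ t → t ≤ runLength κ (u p) → proj (u (r + t)) = proj (u p) := by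
  rcases hc : u p with ⟨b, l⟩
  rcases l with _ | l
  · obtain ⟨q, rfl, hq⟩ := h.pred_chain_of_zero hc (fun hc' => by rw [hc'] at hp; simp at hp)
    refine ⟨q, by simp [runLength, Nat.add_assoc], ?_, fun t ht ht' => ?_⟩
    · have := hq 0 (by omega)
      rw [Nat.add_zero] at this
      rw [this]
      simp [proj]
    · simp only [runLength, if_true] at ht'
      rcases (show t ≤ κ ∨ t = κ + 1 by omega) with h' | rfl
      · rw [hq t h', proj, if_neg (by simp; omega)]
        simp [proj]
      · rw [← Nat.add_assoc, hc]
  · obtain ⟨q, rfl, hq⟩ := h.pred_chain hc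
    refine ⟨q, by simp [runLength], ?_, fun t ht ht' => ?_⟩
    · have := hq 0 (by omega)
      rw [Nat.add_zero] at this
      rw [this]
      simp [proj]
    · simp only [runLength, Nat.add_eq_zero_iff, one_ne_zero, and_false, if_false] at ht'
      rw [hq t ht', proj, if_neg (by simp; omega)]
      simp [proj]

theorem runLength_injective {c d : Letter} (hc : c.2 ≤ κ) (hd : d.2 ≤ κ)
    (hp : proj c = proj d) (hr : runLength κ c = runLength κ d) : c = d := by
  rcases c with ⟨b, l⟩
  rcases d with ⟨b', l'⟩
  unfold proj at hp
  unfold runLength at hr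
  simp only at hc hd hp hr
  split_ifs at hp hr <;> simp_all; omega

/-- Before a common letter preceded by distinct letters, the projections agree exactly on
constant runs of length at most `κ`. -/
theorem common_run (h : XiFixed κ u) {p p' : ℕ} (hne : u p ≠ u p')
    (heq : u (p + 1) = u (p' + 1)) :
    shift κ (u p) (u p') ≤ κ ∧ ∃ r r', p = r + shift κ (u p) (u p') ∧
      p' = r' + shift κ (u p) (u p') ∧ proj (u r) ≠ proj (u r') ∧
      ∀ t, 1 ≤ t → t ≤ shift κ (u p) (u p') →
        proj (u (r + t)) = proj (u p) ∧ proj (u (r' + t)) = proj (u p') ∧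
          proj (u p) = proj (u p') := by
  have h0 : (u (p + 1)).2 = 0 := by
    by_contra hc
    obtain ⟨l, hl⟩ := Nat.exists_eq_succ_of_ne_zero hc
    obtain ⟨q, hq, hq'⟩ := h.pred_of_succ (p := p + 1) (b := (u (p + 1)).1) (j := l)
      (Prod.ext rfl hl)
    obtain ⟨r, hr, hr'⟩ := h.pred_of_succ (p := p' + 1) (b := (u (p + 1)).1) (j := l)
      (heq ▸ Prod.ext rfl hl)
    rw [← Nat.add_right_cancel hq] at hq'
    rw [← Nat.add_right_cancel hr] at hr'
    exact hne (hq'.trans hr'.symm)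
  have hle : ∀ p, runLength κ (u p) ≤ κ + 1 := fun p => by
    have := h.snd_le p
    unfold runLength; split_ifs <;> omega
  unfold shift
  split_ifs with hp
  · obtain ⟨r, hr, hr₁, hr₂⟩ := h.run_before_zero h0
    obtain ⟨r', hr', hr'₁, hr'₂⟩ := h.run_before_zero (heq ▸ h0)
    have hlen : runLength κ (u p) ≠ runLength κ (u p') := fun hc =>
      hne (runLength_injective (h.snd_le p) (h.snd_le p') hp hc)
    have h₁ := hle p
    have h₂ := hle p'
    rcases Nat.lt_or_gt_of_ne hlen with hlt | hlt
    · rw [min_eq_left hlt.le]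
      obtain ⟨d, hd⟩ := Nat.exists_eq_add_of_lt hlt
      refine ⟨by omega, r, r' + (d + 1), hr, by omega, ?_, fun t ht ht' => ⟨hr₂ t ht ht', ?_, hp⟩⟩
      · rw [hr₁, hr'₂ _ (by omega) (by omega), hp]
        simp
      · rw [Nat.add_assoc]
        exact hr'₂ _ (by omega) (by omega)
    · rw [min_eq_right hlt.le]
      obtain ⟨d, hd⟩ := Nat.exists_eq_add_of_lt hlt
      refine ⟨by omega, r + (d + 1), r', by omega, hr', ?_, fun t ht ht' => ⟨?_, hr'₂ t ht ht', hp⟩⟩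
      · rw [hr'₁, hr₂ _ (by omega) (by omega), hp]
        simp
      · rw [Nat.add_assoc]
        exact hr₂ _ (by omega) (by omega)
  · exact ⟨by omega, p, p', rfl, rfl, hp, fun t ht ht' => by omega⟩

/-- The word `0 1^(κ+2)` synchronizes. -/
theorem synchronize (h : XiFixed κ u) {p : ℕ} {b : Bool}
    (hp : ∀ t, 1 ≤ t → t ≤ κ + 2 → proj (u (p + t)) = !b) : u p = (b, 0) := by
  have key : ∀ t, κ + 1 ≤ t → t ≤ κ + 2 → u (p + t) = (!b, 0) := by
    intro t ht ht'
    have hpt := hp t (by omega) ht'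
    rcases hc : u (p + t) with ⟨c, l⟩
    rw [hc] at hpt
    rcases l with _ | l
    · simp only [proj, if_true] at hpt
      rw [hpt]
    · obtain ⟨q, hq, hq'⟩ := h.pred_chain hc
      have hl := h.snd_le (p + t)
      rw [hc] at hl
      simp only at hl
      have h0 := hq' 0 (by omega)
      have h1 := hp (t - (l + 1)) (by omega) (by omega)
      rw [show p + (t - (l + 1)) = q + 0 by omega, h0] at h1
      simp [proj] at hpt h1
      simp [hpt] at h1
  obtain ⟨q, hq, hq'⟩ := h.pred_chain_of_zero (key (κ + 1) (by omega) (by omega)) (by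
    rw [Nat.add_assoc, key (κ + 1 + 1) (by omega) (by omega)]; simp)
  have := hq' 0 (by omega)
  rw [show q + 0 = p by omega] at this
  simpa using this

theorem proj_start (h : XiFixed κ u) {t : ℕ} (ht : 1 ≤ t) (ht' : t ≤ κ + 2) :
    proj (u t) = true := by
  rcases (show t ≤ κ ∨ t = κ + 1 ∨ t = κ + 2 by omega) with h' | rfl | rfl
  · rw [h.start h', proj, if_neg (by simp; omega)]; rfl
  · rw [h.start_kappa_add_one]; rfl
  · rw [h.start_kappa_add_two]; rfl

theorem exists_sync (h : XiFixed κ u) :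
    ∃ K, ∀ p, ∃ i, p ≤ i ∧ i ≤ p + K ∧ ∃ b, ∀ t, 1 ≤ t → t ≤ κ + 2 → proj (u (i + t)) = !b := by
  refine ⟨2 ^ (κ + 2) + κ * 2 ^ (κ + 2), fun p => ?_⟩
  obtain ⟨m, hm, hm'⟩ : ∃ m, p ≤ level u (κ + 2) m ∧ level u (κ + 2) m ≤ p + 2 ^ (κ + 2) := by
    induction p with
    | zero => exact ⟨0, by simp [level_zero]⟩
    | succ p ih =>
      obtain ⟨m, hm, hm'⟩ := ih
      rcases Nat.lt_or_ge p (level u (κ + 2) m) with h' | h'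
      · exact ⟨m, h', by omega⟩
      · have h₁ := level_strictMono u (κ + 2) (Nat.lt_succ_self m)
        have h₂ := level_add_le u (κ + 2) m 1
        simp only [Nat.succ_eq_add_one] at h₁
        exact ⟨m + 1, by omega, by omega⟩
  obtain ⟨q, hq, hq'⟩ := h.pred_chain (p := m + κ) (b := (u (m + κ)).1) rfl
  have hle := h.snd_le (m + κ)
  have h0 := hq' 0 (by omega)
  rw [Nat.add_zero] at h0
  obtain ⟨d, rfl⟩ : ∃ d, q = m + d := ⟨q - m, by omega⟩
  have h₁ := level_add_le u (κ + 2) m d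
  have h₂ := (level_strictMono u (κ + 2)).monotone (show m ≤ m + d by omega)
  have h₃ : d * 2 ^ (κ + 2) ≤ κ * 2 ^ (κ + 2) := Nat.mul_le_mul_right _ (by omega)
  refine ⟨level u (κ + 2) (m + d), by omega, by omega, (u (m + κ)).1, fun t ht ht' => ?_⟩
  have hF := h.lt_F (κ + 2)
  rw [(h.block_one (κ + 2) h0).2 t (by omega), proj_tw, h.proj_start ht ht']
  simp

/-- Long words of `π(u)` determine all letters of `u` except near both ends. -/
theorem recognize (h : XiFixed κ u) :
    ∃ K, ∀ N i j, K ≤ N → proj (u i) ≠ proj (u j) →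
      (∀ t, 1 ≤ t → t ≤ N → proj (u (i + t)) = proj (u (j + t))) →
      ∃ s ≤ κ, s = shift κ (u (i + s)) (u (j + s)) ∧ u (i + s) ≠ u (j + s) ∧
        (∀ t, 1 ≤ t → t + s + K ≤ N → u (i + s + t) = u (j + s + t)) ∧
        ∀ t, 1 ≤ t → t ≤ s →
          proj (u (i + t)) = proj (u (i + s)) ∧ proj (u (j + t)) = proj (u (j + s)) := by
  obtain ⟨K, hK⟩ := h.exists_sync
  refine ⟨K + κ + 3, fun N i j hN hne heq => ?_⟩
  obtain ⟨p, hp₁, hp₂, b, hb⟩ := hK (i + (N - (K + κ + 2)))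
  obtain ⟨p, rfl⟩ : ∃ r, p = i + r := ⟨p - i, by omega⟩
  have hi := h.synchronize hb
  have hj : u (j + p) = (b, 0) := h.synchronize fun t ht ht' => by
    rw [Nat.add_assoc, ← heq _ (by omega) (by omega), ← Nat.add_assoc, hb t ht ht']
  obtain ⟨s, hs, hs', ht⟩ := exists_last_of_not (P := fun s => u (i + s) ≠ u (j + s)) (p := p)
    (fun hc => hne (by simpa using congrArg proj hc)) (by simp [hi, hj])
  simp only [not_not] at ht
  obtain ⟨hle, r, r', hr, hr', hrr, hrun⟩ := h.common_run hs' (ht (s + 1) (by omega) (by omega))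
  set m := shift κ (u (i + s)) (u (j + s)) with hm
  have hms : m = s := by
    rcases Nat.lt_trichotomy m s with hlt | heq' | hlt
    · refine absurd (heq (s - m) (by omega) (by omega)) ?_
      rwa [show i + (s - m) = r by omega, show j + (s - m) = r' by omega]
    · exact heq'
    · obtain ⟨h₁, h₂, h₃⟩ := hrun (m - s) (by omega) (by omega)
      rw [show r + (m - s) = i by omega] at h₁
      rw [show r' + (m - s) = j by omega] at h₂
      exact absurd (h₁.trans (h₃.trans h₂.symm)) hne
  obtain rfl : r = i := by omega
  obtain rfl : r' = j := by omega
  refine ⟨s, by omega, hms.symm, hs', fun t h₁ h₂ => ?_, fun t h₁ h₂ => ?_⟩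
  · rw [Nat.add_assoc, Nat.add_assoc]
    exact ht _ (by omega) (by omega)
  · obtain ⟨h₃, h₄, -⟩ := hrun t h₁ (by omega)
    exact ⟨h₃, h₄⟩

end XiFixed

/-- The word `y^s u` over `{0, 1}`, where `u` is complemented if `b` is true. -/
def stem (u : ℕ → Letter) (b y : Bool) (s t : ℕ) : Bool :=
  if t < s then y else xor b (proj (u (t - s)))

/-- The exponent of the constant run in front of `branch κ u q`. -/
def extraShift (κ q : ℕ) : ℕ :=
  shift κ ((lastLetter κ)^[q + 2 * κ] (true, κ)) ((lastLetter κ)^[q + 2 * κ] (false, 0))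

/-- The projection of `branch κ u q`, preceded by the run common to its two left contexts. -/
def extra (κ : ℕ) (u : ℕ → Letter) (q t : ℕ) : Bool :=
  if t < extraShift κ q then proj ((lastLetter κ)^[q + 2 * κ] (false, 0))
  else proj (branch κ u q (t - extraShift κ q))

namespace XiFixed

variable {κ : ℕ} {u : ℕ → Letter}

/-- The common continuation of two occurrences that can be separated by a letter `0`, up to the
separation, if the second one continues by `01`. -/
def Separated (κ : ℕ) (u : ℕ → Letter) (b : Bool) (i j : ℕ) : Prop :=
  ∃ M, proj (u (i + 1 + M)) ≠ proj (u (j + 1 + M)) ∧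
    ((∀ t < M, u (j + 1 + t) = tw b (u t)) ∨
      ∃ q, u i = tw b ((lastLetter κ)^[q + 2 * κ] (true, κ)) ∧
        u j = tw b ((lastLetter κ)^[q + 2 * κ] (false, 0)) ∧
        M = F u (q + 2 * κ + 1) + F u q ∧ ∀ t < M, u (j + 1 + t) = tw b (branch κ u q t))

theorem apply_of_add_one_eq_level (h : XiFixed κ u) {n i i' : ℕ} (hi : i + 1 = level u n (i' + 1)) :
    u i = (lastLetter κ)^[n] (u i') := by
  rw [← h.level_last, ← hi, Nat.add_sub_cancel]

theorem separated_of_level (h : XiFixed κ u) {N n i j i' j' : ℕ} {b : Bool}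
    (hN : 2 * F u (6 * κ + 1) < N) (heq : ∀ t, 1 ≤ t → t ≤ N → u (i + t) = u (j + t))
    (hi : i + 1 = level u n (i' + 1)) (hj : j + 1 = level u n (j' + 1))
    (hi₀ : u (i' + 1) = (b, 0)) (hi₁ : u (i' + 2) ≠ (b, 1))
    (hj₀ : u (j' + 1) = (b, 0)) (hj₁ : u (j' + 2) = (b, 1)) :
    Separated κ u b i j := by
  by_cases hn : 3 * κ ≤ n
  · obtain ⟨q, rfl⟩ : ∃ q, n = q + 2 * κ := ⟨n - 2 * κ, by omega⟩
    obtain ⟨M, -, ⟨c, hc, hc'⟩, hM⟩ := h.dichotomy (q := q) (by omega) hi₀ hi₁ hj₀ hj₁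
    rw [← hi] at hc
    rw [← hj] at hc' hM
    refine ⟨M, by rw [hc, hc']; simp [proj], hM.imp_right ?_⟩
    rintro ⟨h₁, h₂, h₃, h₄⟩
    refine ⟨q, ?_, ?_, h₃, h₄⟩
    · rw [h.apply_of_add_one_eq_level hi, h₁, ← iterate_lastLetter_tw]
      simp [tw]
    · rw [h.apply_of_add_one_eq_level hj, h₂, ← iterate_lastLetter_tw]
      simp [tw]
  · obtain ⟨M, hM, ⟨c, hc, hc'⟩, -⟩ := h.dichotomy (q := n + κ) (by omega) hi₀ hi₁ hj₀ hj₁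
    rw [show n + κ + 2 * κ = 3 * κ + n by ring, level_add, ← hi] at hc
    rw [show n + κ + 2 * κ = 3 * κ + n by ring, level_add, ← hj] at hc'
    obtain ⟨d, hd, -, -, hd'⟩ := h.level_agree (3 * κ) (b := false) (p := i + 1) (q := j + 1)
      (m := N) fun t ht => by
        rw [tw_false, Nat.add_assoc, Nat.add_assoc]
        exact heq _ (by omega) (by omega)
    have hF : F u (n + κ + 2 * κ + 1) ≤ F u (6 * κ + 1) := h.F_strictMono.monotone (by omega)
    have := hd' M (by omega)
    rw [hc, hc', tw_false] at this
    simp at this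

theorem separated (h : XiFixed κ u) {N i j : ℕ} (hN : 2 * F u (6 * κ + 1) < N) (hne : u i ≠ u j)
    (heq : ∀ t, 1 ≤ t → t ≤ N → u (i + t) = u (j + t)) :
    ∃ b, Separated κ u b i j ∨ Separated κ u b j i := by
  obtain ⟨n, i', j', hi, hj, h₀, h₁, h₂⟩ := h.desubstitute hne (heq 1 le_rfl (by omega))
  obtain ⟨b, hb, hb', ⟨h₃, h₄⟩ | ⟨h₃, h₄⟩⟩ := h.base_pair h₀ h₁ h₂
  · exact ⟨b, Or.inl (h.separated_of_level hN heq hi hj hb h₃ hb' h₄)⟩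
  · exact ⟨b, Or.inr (h.separated_of_level hN (fun t ht ht' => (heq t ht ht').symm)
      hj hi hb' h₃ hb h₄)⟩

theorem classify_of_separated {N i j s : ℕ} {b : Bool}
    (heq : ∀ t, 1 ≤ t → t ≤ N → proj (u (i + t)) = proj (u (j + t)))
    (hs : s = shift κ (u (i + s)) (u (j + s))) (hsκ : s ≤ κ)
    (hrun : ∀ t, 1 ≤ t → t ≤ s → proj (u (j + t)) = proj (u (j + s)))
    (hsep : Separated κ u b (i + s) (j + s)) :
    (∃ b y, ∃ s ≤ κ, ∀ t < N, proj (u (j + 1 + t)) = stem u b y s t) ∨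
      ∃ b q, extraShift κ q ≤ κ ∧ extraShift κ q + F u (q + 2 * κ + 1) < N ∧
        N ≤ extraShift κ q + F u (q + 2 * κ + 1) + F u q ∧
        ∀ t < N, proj (u (j + 1 + t)) = xor b (extra κ u q t) := by
  obtain ⟨M, hM, hM'⟩ := hsep
  have hNM : N ≤ s + M := by
    by_contra hc
    refine hM ?_
    rw [show i + s + 1 + M = i + (s + 1 + M) by ring, show j + s + 1 + M = j + (s + 1 + M) by ring]
    exact heq _ (by omega) (by omega)
  have key : ∀ w : ℕ → Letter, (∀ t < M, u (j + s + 1 + t) = tw b (w t)) → ∀ t < N,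
      proj (u (j + 1 + t)) = if t < s then proj (u (j + s)) else xor b (proj (w (t - s))) := by
    intro w hw t ht
    split_ifs with hts
    · rw [Nat.add_assoc]
      exact hrun _ (by omega) (by omega)
    · rw [← proj_tw, ← hw _ (by omega)]
      congr 2
      omega
  rcases hM' with hM' | ⟨q, hi, hj, rfl, hq⟩
  · exact Or.inl ⟨b, proj (u (j + s)), s, hsκ, key u hM'⟩
  · rw [hi, hj, shift_tw] at hs
    replace hs : s = extraShift κ q := hs
    rcases Nat.lt_or_ge (s + F u (q + 2 * κ + 1)) N with hlt | hge
    · refine Or.inr ⟨b, q, hs ▸ hsκ, hs ▸ hlt, by omega, fun t ht => ?_⟩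
      rw [key _ hq t ht, extra, ← hs, hj, proj_tw]
      split_ifs <;> rfl
    · refine Or.inl ⟨b, proj (u (j + s)), s, hsκ, fun t ht => ?_⟩
      rw [key _ hq t ht, stem]
      split_ifs with hts
      · rfl
      · rw [branch, if_pos (by omega)]

/-- Classification of the long left special factors of `π(u)`. -/
theorem classify (h : XiFixed κ u) :
    ∃ N₀, ∀ N i j, N₀ ≤ N → proj (u i) ≠ proj (u j) →
      (∀ t, 1 ≤ t → t ≤ N → proj (u (i + t)) = proj (u (j + t))) →
      (∃ b y, ∃ s ≤ κ, ∀ t < N, proj (u (j + 1 + t)) = stem u b y s t) ∨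
      ∃ b q, extraShift κ q ≤ κ ∧ extraShift κ q + F u (q + 2 * κ + 1) < N ∧
        N ≤ extraShift κ q + F u (q + 2 * κ + 1) + F u q ∧
        ∀ t < N, proj (u (j + 1 + t)) = xor b (extra κ u q t) := by
  obtain ⟨K, hK⟩ := h.recognize
  refine ⟨K + κ + 2 * F u (6 * κ + 1) + 1, fun N i j hN hne heq => ?_⟩
  obtain ⟨s, hsκ, hs, hs', hagree, hrun⟩ := hK N i j (by omega) hne heq
  obtain ⟨b, hb | hb⟩ := h.separated (N := N - s - K) (by omega) hs'
    fun t ht ht' => hagree t ht (by omega)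
  · exact classify_of_separated heq hs hsκ (fun t ht ht' => (hrun t ht ht').2) hb
  · have heq' : ∀ t < N, proj (u (j + 1 + t)) = proj (u (i + 1 + t)) := fun t ht => by
      rw [Nat.add_assoc, Nat.add_assoc]
      exact (heq _ (by omega) (by omega)).symm
    have := classify_of_separated (fun t ht ht' => (heq t ht ht').symm) (hs.trans (shift_comm ..)) hsκ
      (fun t ht ht' => (hrun t ht ht').1) hb
    refine this.imp ?_ ?_
    · rintro ⟨b, y, s, hs, hw⟩
      exact ⟨b, y, s, hs, fun t ht => (heq' t ht).trans (hw t ht)⟩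
    · rintro ⟨b, q, h₁, h₂, h₃, hw⟩
      exact ⟨b, q, h₁, h₂, h₃, fun t ht => (heq' t ht).trans (hw t ht)⟩

/-- At most one pair of complementary exceptional words exists for each length. -/
theorem extra_unique (h : XiFixed κ u) {N q q' : ℕ} (hs' : extraShift κ q' ≤ κ)
    (hs : extraShift κ q ≤ κ)
    (h₁ : extraShift κ q + F u (q + 2 * κ + 1) < N)
    (h₂ : N ≤ extraShift κ q + F u (q + 2 * κ + 1) + F u q)
    (h₁' : extraShift κ q' + F u (q' + 2 * κ + 1) < N)
    (h₂' : N ≤ extraShift κ q' + F u (q' + 2 * κ + 1) + F u q') : q = q' := by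
  have key : ∀ {a b}, a < b → κ + F u (a + 2 * κ + 1) + F u a ≤ F u (b + 2 * κ + 1) := by
    intro a b hab
    have hmono : F u (a + κ + 1 + κ + 1) ≤ F u (b + 2 * κ + 1) :=
      h.F_strictMono.monotone (by omega)
    rw [(h.F_add (a + κ + 1)).1, (h.F_add a).1,
      show a + κ + 1 + κ = a + 2 * κ + 1 by ring] at hmono
    have := h.lt_F (a + κ)
    omega
  rcases Nat.lt_trichotomy q q' with hlt | heq | hlt
  · have := key hlt; omega
  · exact heq
  · have := key hlt; omega

end XiFixed

namespace XiFixed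

variable {κ : ℕ} {u : ℕ → Letter}

theorem iterate_lastLetter_zero {κ n : ℕ} (b : Bool) (hn : n ≤ κ) :
    (lastLetter κ)^[n] (b, 0) = (b, n) := by
  induction n with
  | zero => rfl
  | succ n ih =>
    rw [Function.iterate_succ_apply', ih (by omega), lastLetter, if_neg (by simp; omega)]

theorem iterate_lastLetter_period (κ : ℕ) (b : Bool) :
    (lastLetter κ)^[κ + 1] (b, 0) = (!b, 0) := by
  rw [Function.iterate_succ_apply', iterate_lastLetter_zero b le_rfl]
  simp [lastLetter]

theorem exists_iterate_lastLetter {κ : ℕ} (b : Bool) {c : Letter} (hc : c.2 ≤ κ) (N : ℕ) :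
    ∃ m, N ≤ m ∧ (lastLetter κ)^[m] (b, 0) = c := by
  induction N with
  | zero =>
    rcases c with ⟨c, j⟩
    by_cases hcb : c = b
    · exact ⟨j, by omega, hcb ▸ iterate_lastLetter_zero c hc⟩
    · refine ⟨j + (κ + 1), by omega, ?_⟩
      rw [Function.iterate_add_apply, iterate_lastLetter_period, iterate_lastLetter_zero _ hc]
      rw [Bool.eq_not_of_ne hcb]
  | succ N ih =>
    obtain ⟨m, hm, hm'⟩ := ih
    refine ⟨m + (κ + 1) + (κ + 1), by omega, ?_⟩
    rw [Function.iterate_add_apply, Function.iterate_add_apply, iterate_lastLetter_period,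
      iterate_lastLetter_period, Bool.not_not, hm']

theorem exists_square (h : XiFixed κ u) (b : Bool) : ∃ q, u q = (b, 0) ∧ u (q + 1) = (b, 0) := by
  cases b with
  | true => exact ⟨κ + 1, h.start_kappa_add_one, h.start_kappa_add_two⟩
  | false =>
    have hF := h.lt_F (κ + 2)
    have hb := (h.block_one (κ + 2) h.start_kappa_add_one).2
    refine ⟨level u (κ + 2) (κ + 1) + (κ + 1), ?_, ?_⟩
    · rw [hb _ (by omega), h.start_kappa_add_one]; rfl
    · rw [Nat.add_assoc, hb _ (by omega), h.start_kappa_add_two]; rfl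

/-- Prefixes of `u` and their twins may be preceded by any letter. -/
theorem exists_preceded (h : XiFixed κ u) (b : Bool) {c : Letter} (hc : c.2 ≤ κ) (N : ℕ) :
    ∃ i, u i = c ∧ ∀ t < N, u (i + 1 + t) = tw b (u t) := by
  obtain ⟨q, hq, hq'⟩ := h.exists_square b
  obtain ⟨m, hm, hm'⟩ := exists_iterate_lastLetter b hc N
  have hle := h.le_level m (i := q + 1) (by omega)
  have hF := h.lt_F m
  refine ⟨level u m (q + 1) - 1, ?_, fun t ht => ?_⟩
  · rw [h.level_last, hq, hm']
  · rw [Nat.sub_add_cancel (by omega)]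
    exact (h.block_one m hq').2 t (by omega)

theorem exists_twin (h : XiFixed κ u) (b : Bool) (j N : ℕ) :
    ∃ p, ∀ t < N, u (p + 1 + t) = tw b (u (j + t)) := by
  obtain ⟨i, -, hi⟩ := h.exists_preceded b (c := (false, 0)) (by simp) (j + N)
  refine ⟨i + j, fun t ht => ?_⟩
  rw [← hi (j + t) (by omega)]
  congr 1
  omega

theorem exists_letter {κ l : ℕ} (y : Bool) (hl : 1 ≤ l) (hl' : l ≤ κ + 1) :
    ∃ c : Letter, c.2 ≤ κ ∧ proj c = y ∧ runLength κ c = l := by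
  by_cases h : l = κ + 1
  · exact ⟨(y, 0), by simp, by simp [proj], by simp [runLength, h]⟩
  · exact ⟨(!y, l), by simp; omega, by rw [proj, if_neg (by simp; omega)]; simp,
      by rw [runLength, if_neg (by simp; omega)]⟩

theorem exists_stem_of_letter (h : XiFixed κ u) (b : Bool) {c : Letter} {s : ℕ} (hc : c.2 ≤ κ)
    (hs : s ≤ runLength κ c) (N : ℕ) :
    ∃ p, proj (u p) = (if s = runLength κ c then !proj c else proj c) ∧
      ∀ t < N, proj (u (p + 1 + t)) = stem u b (proj c) s t := by
  obtain ⟨i, hi, hu⟩ := h.exists_preceded b hc (N + 1)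
  have h0 : (u (i + 1)).2 = 0 := by
    have := hu 0 (by omega)
    rw [Nat.add_zero, h.zero] at this
    rw [this]
    rfl
  obtain ⟨r, hr, hr₀, hrun⟩ := h.run_before_zero h0
  rw [hi] at hr hr₀ hrun
  obtain ⟨d, hd⟩ := Nat.exists_eq_add_of_le hs
  refine ⟨r + d, ?_, fun t ht => ?_⟩
  · split_ifs with hsl
    · rw [show d = 0 by omega, Nat.add_zero, hr₀]
    · exact hrun d (by omega) (by omega)
  · unfold stem
    split_ifs with hts
    · rw [← hrun (d + 1 + t) (by omega) (by omega), ← Nat.add_assoc, ← Nat.add_assoc]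
    · rw [← proj_tw, ← hu (t - s) (by omega)]
      congr 2
      omega

/-- The words `stem u b y s` with `s ≤ κ` have both left extensions in `π(u)`. -/
theorem exists_stem (h : XiFixed κ u) (a b y : Bool) {s : ℕ} (hs : s ≤ κ) (N : ℕ) :
    ∃ p, proj (u p) = a ∧ ∀ t < N, proj (u (p + 1 + t)) = stem u b y s t := by
  by_cases ha : y = a
  · subst ha
    obtain ⟨c, hc, hy, hl⟩ := exists_letter (κ := κ) (l := s + 1) y (by omega) (by omega)
    have := h.exists_stem_of_letter b (s := s) hc (by omega) N
    rwa [if_neg (by omega), hy] at this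
  · obtain rfl := Bool.eq_not_of_ne (Ne.symm ha)
    rcases Nat.eq_zero_or_pos s with rfl | hpos
    · obtain ⟨c, hc, hy, hl⟩ := exists_letter (κ := κ) (l := 1) (!y) (by omega) (by omega)
      have := h.exists_stem_of_letter b (s := 0) hc (by omega) N
      rw [if_neg (by omega), hy] at this
      simpa [stem] using this
    · obtain ⟨c, hc, rfl, hl⟩ := exists_letter (κ := κ) (l := s) y (by omega) (by omega)
      have := h.exists_stem_of_letter b (s := s) hc (by omega) N
      rwa [if_pos hl.symm] at this

theorem stem_injective (h : XiFixed κ u) {b b' y y' : Bool} {s s' N : ℕ} (hN : κ + 2 ≤ N)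
    (hs : s ≤ κ) (hs' : s' ≤ κ) (heq : ∀ t < N, stem u b y s t = stem u b' y' s' t) :
    s = s' ∧ b = b' ∧ (1 ≤ s → y = y') := by
  have key : ∀ {b b' y y' : Bool} {s s' : ℕ}, s ≤ κ → s' ≤ κ →
      (∀ t < N, stem u b y s t = stem u b' y' s' t) → ¬ s < s' := by
    intro b b' y y' s s' hs hs' heq hlt
    have h₁ := heq s' (by omega)
    have h₂ := heq (s' + 1) (by omega)
    unfold stem at h₁ h₂
    rw [if_neg (by omega), if_neg (by omega), Nat.sub_self, h.zero,
      h.proj_start (by omega) (by omega)] at h₁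
    rw [if_neg (by omega), if_neg (by omega), Nat.add_sub_cancel_left,
      h.proj_start (by omega) (by omega), h.proj_start le_rfl (by omega)] at h₂
    rw [h₂] at h₁
    revert h₁
    cases b' <;> simp [proj]
  obtain rfl : s = s' := by
    have := key hs hs' heq
    have := key hs' hs fun t ht => (heq t ht).symm
    omega
  refine ⟨rfl, ?_, fun hs1 => ?_⟩
  · have := heq s (by omega)
    simpa [stem] using this
  · have := heq 0 (by omega)
    simpa [stem, show 0 < s by omega] using this

end XiFixed

section Complexity

variable {v : ℕ → Bool}

/-- The prefix of length `N` of an infinite word. -/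
def word {α : Type*} (N : ℕ) (f : ℕ → α) : List α := (List.range N).map f

theorem length_word {α : Type*} (N : ℕ) (f : ℕ → α) : (word N f).length = N := by simp [word]

theorem word_eq_iff {α : Type*} {N : ℕ} {f g : ℕ → α} : word N f = word N g ↔ ∀ t < N, f t = g t := by
  simp [word, List.map_inj_left]

theorem map_word {α β : Type*} (N : ℕ) (f : ℕ → α) (g : α → β) :
    (word N f).map g = word N (g ∘ f) := by simp [word]

theorem factorOf_iff {α : Type*} {v : ℕ → α} {w : List α} :
    FactorOf w v ↔ ∃ j, w = word w.length fun t => v (j + t) :=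
  exists_congr fun _ => occursAt_iff

theorem factorOf_word {α : Type*} {v f : ℕ → α} {N : ℕ} :
    FactorOf (word N f) v ↔ ∃ j, ∀ t < N, v (j + t) = f t := by
  simp only [factorOf_iff, length_word, word_eq_iff, eq_comm]

theorem factorOf_cons_word {α : Type*} {v f : ℕ → α} {N : ℕ} {a : α} :
    FactorOf (a :: word N f) v ↔ ∃ j, v j = a ∧ ∀ t < N, v (j + 1 + t) = f t := by
  have : a :: word N f = word (N + 1) fun t => Nat.casesOn t a f := by
    simp [word, List.range_succ_eq_map]
  rw [this, factorOf_word]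
  refine exists_congr fun j => ⟨fun h => ⟨h 0 (by omega), fun t ht => ?_⟩, ?_⟩
  · rw [Nat.add_assoc, Nat.add_comm 1]
    exact h (t + 1) (by omega)
  · rintro ⟨h₁, h₂⟩ (_ | t) ht
    · exact h₁
    · rw [Nat.add_comm t, ← Nat.add_assoc, h₂ t (by omega), Nat.add_comm 1]

theorem exists_eq_word {α : Type*} {v : ℕ → α} {w : List α} {a : α} (h : FactorOf (a :: w) v) :
    ∃ f : ℕ → α, w = word w.length f := by
  obtain ⟨j, hj⟩ := factorOf_iff.1 h
  refine ⟨fun t => v (j + (t + 1)), ?_⟩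
  rw [List.length_cons] at hj
  simp only [word, List.range_succ_eq_map, List.map_cons, List.cons.injEq, List.map_map] at hj
  exact hj.2

/-- The factors of length `N` that can be extended to the left by both letters. -/
def bothExtensions (v : ℕ → Bool) (N : ℕ) : Set (List Bool) :=
  {w | w.length = N ∧ FactorOf (true :: w) v ∧ FactorOf (false :: w) v}

theorem finite_length_and (N : ℕ) (P : List Bool → Prop) :
    {w : List Bool | w.length = N ∧ P w}.Finite :=
  (List.finite_length_eq Bool N).subset fun _ hw => hw.1

theorem factorOf_tail {α : Type*} {v : ℕ → α} {w : List α} {a : α} (h : FactorOf (a :: w) v) :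
    FactorOf w v :=
  h.imp' (· + 1) fun _ hj => occursAt_append (w := [a]) hj

theorem complexity_succ (hv : ∀ w, FactorOf w v → ∃ a, FactorOf (a :: w) v) (N : ℕ) :
    complexity v (N + 1) = complexity v N + (bothExtensions v N).ncard := by
  set A : Bool → Set (List Bool) := fun a => {w | w.length = N ∧ FactorOf (a :: w) v} with hA
  have hfin : ∀ a, (A a).Finite := fun a => finite_length_and N _
  have h₁ : {w | w.length = N + 1 ∧ FactorOf w v} =
      List.cons true '' A true ∪ List.cons false '' A false := by
    ext w
    rcases w with _ | ⟨_ | _, w⟩ <;> simp [hA]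
  have h₂ : {w | w.length = N ∧ FactorOf w v} = A true ∪ A false := by
    ext w
    constructor
    · rintro ⟨hw, hw'⟩
      obtain ⟨_ | _, ha⟩ := hv w hw'
      exacts [Or.inr ⟨hw, ha⟩, Or.inl ⟨hw, ha⟩]
    · rintro (⟨hw, hw'⟩ | ⟨hw, hw'⟩) <;> exact ⟨hw, factorOf_tail hw'⟩
  have h₃ : bothExtensions v N = A true ∩ A false := by
    ext w
    simp only [bothExtensions, hA, Set.mem_inter_iff, Set.mem_ofPred_eq]
    tauto
  have hdisj : Disjoint (List.cons true '' A true) (List.cons false '' A false) := by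
    rw [Set.disjoint_left]
    rintro _ ⟨w, -, rfl⟩ ⟨w', -, hw⟩
    simp at hw
  rw [complexity, complexity, h₁, h₂, h₃,
    Set.ncard_union_add_ncard_inter _ _ (hfin _) (hfin _),
    Set.ncard_union_eq hdisj ((hfin _).image _) ((hfin _).image _),
    Set.ncard_image_of_injective _ List.cons_injective,
    Set.ncard_image_of_injective _ List.cons_injective]

end Complexity

namespace XiFixed

variable {κ : ℕ} {u : ℕ → Letter}

theorem factorOf_map_not (h : XiFixed κ u) {w : List Bool}
    (hw : FactorOf w fun n => proj (u n)) : FactorOf (w.map not) fun n => proj (u n) := by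
  obtain ⟨j, hj⟩ := factorOf_iff.1 hw
  obtain ⟨p, hp⟩ := h.exists_twin true j w.length
  rw [hj, map_word, factorOf_word]
  exact ⟨p + 1, fun t ht => by rw [hp t ht, proj_tw]; simp⟩

theorem exists_factorOf_cons (h : XiFixed κ u) {w : List Bool}
    (hw : FactorOf w fun n => proj (u n)) : ∃ a, FactorOf (a :: w) fun n => proj (u n) := by
  obtain ⟨j, hj⟩ := factorOf_iff.1 hw
  obtain ⟨p, hp⟩ := h.exists_twin false j w.length
  refine ⟨proj (u p), ?_⟩
  rw [hj, factorOf_cons_word]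
  exact ⟨p, rfl, fun t ht => by rw [hp t ht, tw_false]⟩

theorem map_not_mem_bothExtensions (h : XiFixed κ u) {N : ℕ} {w : List Bool}
    (hw : w ∈ bothExtensions (fun n => proj (u n)) N) :
    w.map not ∈ bothExtensions (fun n => proj (u n)) N :=
  ⟨by rw [List.length_map, hw.1], h.factorOf_map_not hw.2.2, h.factorOf_map_not hw.2.1⟩

/-- The prefixes of length `N` of the words `stem u b y s` with `s ≤ κ`. -/
def stems (κ : ℕ) (u : ℕ → Letter) (N : ℕ) : Set (List Bool) :=
  {w | ∃ b y, ∃ s ≤ κ, w = word N (stem u b y s)}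

theorem ncard_stems (h : XiFixed κ u) {N : ℕ} (hN : κ + 2 ≤ N) :
    (stems κ u N).ncard = 4 * κ + 2 := by
  let φ : Bool ⊕ (Bool × Bool × Fin κ) → List Bool :=
    Sum.elim (fun b => word N (stem u b false 0)) fun a => word N (stem u a.1 a.2.1 (a.2.2 + 1))
  have hφ : Function.Injective φ := by
    rintro (b | ⟨b, y, s⟩) (b' | ⟨b', y', s'⟩) heq
    all_goals
      have := h.stem_injective hN (by omega) (by omega) (word_eq_iff.1 heq)
      simp [Fin.ext_iff] at this ⊢
      try tauto
  have hrange : stems κ u N = Set.range φ := by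
    ext w
    constructor
    · rintro ⟨b, y, _ | s, hs, rfl⟩
      · refine ⟨Sum.inl b, word_eq_iff.2 fun t _ => ?_⟩
        simp [stem]
      · exact ⟨Sum.inr (b, y, ⟨s, hs⟩), rfl⟩
    · rintro ⟨b | ⟨b, y, s⟩, rfl⟩
      · exact ⟨b, false, 0, by omega, rfl⟩
      · exact ⟨b, y, s + 1, by omega, rfl⟩
  rw [hrange, ← Set.image_univ, Set.ncard_image_of_injective _ hφ, Set.ncard_univ,
    Nat.card_eq_fintype_card]
  simp
  ring

theorem stems_subset (h : XiFixed κ u) (N : ℕ) :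
    stems κ u N ⊆ bothExtensions (fun n => proj (u n)) N := by
  rintro _ ⟨b, y, s, hs, rfl⟩
  exact ⟨length_word .., factorOf_cons_word.2 (h.exists_stem true b y hs N),
    factorOf_cons_word.2 (h.exists_stem false b y hs N)⟩

theorem map_not_mem_stems {N : ℕ} {w : List Bool} (hw : w ∈ stems κ u N) :
    w.map not ∈ stems κ u N := by
  obtain ⟨b, y, s, hs, rfl⟩ := hw
  refine ⟨!b, !y, s, hs, ?_⟩
  rw [map_word, word_eq_iff]
  intro t _
  simp only [Function.comp, stem]
  split_ifs <;> simp

/-- Long words with both left extensions in `π(u)` are stems, up to one pair of complementary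
words. -/
theorem exists_not_mem_stems (h : XiFixed κ u) : ∃ N₀, ∀ N, N₀ ≤ N →
    ∀ w ∈ bothExtensions (fun n => proj (u n)) N, w ∉ stems κ u N →
      ∀ w' ∈ bothExtensions (fun n => proj (u n)) N, w' ∉ stems κ u N → w' = w ∨ w' = w.map not := by
  obtain ⟨N₀, hN₀⟩ := h.classify
  refine ⟨N₀, fun N hN w hw hws w' hw' hws' => ?_⟩
  have key : ∀ w ∈ bothExtensions (fun n => proj (u n)) N, w ∉ stems κ u N →
      ∃ b q, extraShift κ q ≤ κ ∧ extraShift κ q + F u (q + 2 * κ + 1) < N ∧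
        N ≤ extraShift κ q + F u (q + 2 * κ + 1) + F u q ∧
        w = word N fun t => xor b (extra κ u q t) := by
    rintro w ⟨rfl, h₁, h₂⟩ hs
    obtain ⟨f, hf⟩ := exists_eq_word h₁
    rw [hf, factorOf_cons_word] at h₁ h₂
    obtain ⟨i, hi, hi'⟩ := h₁
    obtain ⟨j, hj, hj'⟩ := h₂
    rcases hN₀ w.length i j hN (by rw [hi, hj]; simp) (fun t ht ht' => by
      have h₃ := (hi' (t - 1) (by omega)).trans (hj' (t - 1) (by omega)).symm
      simpa only [Nat.add_assoc, Nat.add_sub_cancel' ht] using h₃) with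
      ⟨b, y, s, hsκ, ht⟩ | ⟨b, q, h₃, h₄, h₅, ht⟩
    · refine absurd ⟨b, y, s, hsκ, ?_⟩ hs
      rw [hf, length_word, word_eq_iff]
      exact fun t htN => (hj' t htN).symm.trans (ht t htN)
    · refine ⟨b, q, h₃, h₄, h₅, ?_⟩
      rw [hf, length_word, word_eq_iff]
      exact fun t htN => (hj' t htN).symm.trans (ht t htN)
  obtain ⟨b, q, h₁, h₂, h₃, rfl⟩ := key w hw hws
  obtain ⟨b', q', h₁', h₂', h₃', rfl⟩ := key w' hw' hws'
  obtain rfl := h.extra_unique h₁' h₁ h₂ h₃ h₂' h₃'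
  rw [map_word, word_eq_iff, word_eq_iff]
  by_cases hb : b' = b
  · exact Or.inl fun t _ => by rw [hb]
  · exact Or.inr fun t _ => by rw [Bool.eq_not_of_ne hb]; simp

theorem ncard_bothExtensions (h : XiFixed κ u) : ∃ N₀, ∀ N, N₀ ≤ N →
    (bothExtensions (fun n => proj (u n)) N).ncard = 4 * κ + 2 ∨
      (bothExtensions (fun n => proj (u n)) N).ncard = 4 * κ + 4 := by
  obtain ⟨N₀, hN₀⟩ := h.exists_not_mem_stems
  refine ⟨N₀ + κ + 2, fun N hN => ?_⟩
  have hfin : (bothExtensions (fun n => proj (u n)) N).Finite := finite_length_and N _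
  have hcard := h.ncard_stems (N := N) (by omega)
  by_cases hsub : bothExtensions (fun n => proj (u n)) N ⊆ stems κ u N
  · exact Or.inl (by rw [hsub.antisymm (h.stems_subset N), hcard])
  · obtain ⟨w, hw, hws⟩ := Set.not_subset.1 hsub
    have hws' : w.map not ∉ stems κ u N := fun hc => hws (by simpa [Function.comp_def] using map_not_mem_stems hc)
    have hne : w ≠ w.map not := by
      rcases w with _ | ⟨a, w⟩
      · have := hw.1
        simp at this
        omega
      · simp
    have heq : bothExtensions (fun n => proj (u n)) N = stems κ u N ∪ {w, w.map not} := by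
      refine Set.Subset.antisymm (fun w' hw' => ?_) (Set.union_subset (h.stems_subset N) ?_)
      · by_cases hs : w' ∈ stems κ u N
        · exact Or.inl hs
        · exact Or.inr (hN₀ N (by omega) w hw hws w' hw' hs)
      · rintro _ (rfl | rfl)
        exacts [hw, h.map_not_mem_bothExtensions hw]
    have hdisj : Disjoint (stems κ u N) {w, w.map not} := by
      rw [Set.disjoint_right]
      rintro _ (rfl | rfl)
      exacts [hws, hws']
    right
    rw [heq, Set.ncard_union_eq hdisj (hfin.subset (h.stems_subset N)) (Set.toFinite _), hcard,
      Set.ncard_pair hne]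

end XiFixed

end ThueMorseLike

/-- for `k ≥ 2`, the first difference of factor complexity of
`x_k = π(u_k)` eventually takes only the values `4k−2` and `4k`. -/
theorem stmt_0 (k : ℕ) (hk : 2 ≤ k) (u : ℕ → Letter) (hu : IsFixedPoint k u)
    (x : ℕ → Bool) (hx : x = fun n => proj (u n)) :
    ∃ N₀ : ℕ, ∀ N, N₀ ≤ N →
      complexity x (N + 1) = complexity x N + (4 * k - 2) ∨
      complexity x (N + 1) = complexity x N + 4 * k := by
  obtain ⟨κ, rfl⟩ : ∃ κ, k = κ + 1 := ⟨k - 1, by omega⟩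
  have h := ThueMorseLike.xiFixed_of_isFixedPoint (by omega) hu
  obtain ⟨N₀, hN₀⟩ := h.ncard_bothExtensions
  refine ⟨N₀, fun N hN => ?_⟩
  subst hx
  rw [ThueMorseLike.complexity_succ fun w hw => h.exists_factorOf_cons hw]
  have := hN₀ N hN
  omega
end

section
/- Let k ≥ 4. Every nonempty bispecial factor of u_k is, up to the twin map, equal to ξ^n(0) or to ξ^{n+2k−1}(0)ξ^n(0) for some n ∈ ℕ. Moreover, the set of left extensions of ξ^n(0) in u_k is the whole alphabet A, while ξ^{n+2k−1}(0)ξ^n(0) has exactly 2 left extensions in u_k. -/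
open List Filter Topology

/-! ### The morphism on letters and words -/

/-- The last letter of `ξ(a)`. -/
def lam (k : ℕ) (a : Letter) : Letter := if a.2 = k - 1 then (!a.1, 0) else (a.1, a.2 + 1)

/-- The first letter of `ξ(a)`. -/
def hd (k : ℕ) (a : Letter) : Letter := if a.2 = 0 then a else lam k a

/-- The word `ξ^n(0)` or its twin. -/
def zeroPow (k : ℕ) (s : Bool) (n : ℕ) : List Letter := (xiW k)^[n] [(s, 0)]

/-- The language of the fixed point. -/
def InL (k : ℕ) (w : List Letter) : Prop := ∃ n, w <:+: xiPow k n

lemma lam_injective (k : ℕ) : Function.Injective (lam k) := by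
  rintro ⟨a, i⟩ ⟨b, j⟩ h
  unfold lam at h
  cases a <;> cases b <;> grind

lemma lam_ne_self (k : ℕ) (hk : 4 ≤ k) (a : Letter) : lam k a ≠ a := by
  obtain ⟨a, i⟩ := a
  unfold lam
  grind

lemma hd_snd_ne_one (k : ℕ) (a : Letter) : (hd k a).2 ≠ 1 := by
  obtain ⟨a, i⟩ := a
  unfold hd lam
  grind

lemma eq_of_hd_zero {k : ℕ} {c : Letter} {s : Bool} (h : hd k c = (s, 0)) :
    c = (s, 0) ∨ c = (!s, k - 1) := by
  obtain ⟨a, i⟩ := c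
  unfold hd lam at h
  cases a <;> cases s <;> grind

lemma lam_iterate_lt {k i : ℕ} (s : Bool) (hi : i < k) : (lam k)^[i] (s, 0) = (s, i) := by
  induction i with
  | zero => rfl
  | succ i ih =>
    rw [Function.iterate_succ_apply', ih (by omega), lam, if_neg (by simp; omega)]

lemma lam_iterate_k {k : ℕ} (hk : 4 ≤ k) (s : Bool) : (lam k)^[k] (s, 0) = (!s, 0) := by
  obtain ⟨m, rfl⟩ : ∃ m, k = m + 1 := ⟨k - 1, by omega⟩
  rw [Function.iterate_succ_apply', lam_iterate_lt s (by omega)]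
  simp [lam]

lemma lam_iterate_add_k {k : ℕ} (hk : 4 ≤ k) (s : Bool) (i : ℕ) :
    (lam k)^[i + k] (s, 0) = (lam k)^[i] (!s, 0) := by
  rw [Function.iterate_add_apply, lam_iterate_k hk]

lemma xiL_eq_single {k : ℕ} {a : Letter} (h : a.2 ≠ 0) : xiL k a = [lam k a] := by
  unfold xiL lam
  split_ifs <;> simp_all

lemma xiL_zero (k : ℕ) (s : Bool) : xiL k (s, 0) = [(s, 0), (s, 1)] := by simp [xiL]

lemma exists_xiL_eq {k : ℕ} (hk : 4 ≤ k) (a : Letter) : ∃ q, xiL k a = q ++ [lam k a] := by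
  obtain ⟨s, i⟩ := a
  by_cases h : i = 0
  · subst h
    exact ⟨[(s, 0)], by simp [xiL, lam]; omega⟩
  · exact ⟨[], by simp [xiL_eq_single (k := k) (a := (s, i)) h]⟩

lemma exists_xiL_eq_cons (k : ℕ) (a : Letter) : ∃ q, xiL k a = hd k a :: q := by
  obtain ⟨s, i⟩ := a
  by_cases h : i = 0
  · subst h
    exact ⟨[(s, 1)], by simp [xiL, hd]⟩
  · exact ⟨[], by simp [xiL_eq_single (k := k) (a := (s, i)) h, hd, h]⟩

@[simp] lemma xiW_nil (k : ℕ) : xiW k [] = [] := rfl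

lemma xiW_cons (k : ℕ) (a : Letter) (w : List Letter) : xiW k (a :: w) = xiL k a ++ xiW k w := by
  simp [xiW]

lemma xiW_append (k : ℕ) (v w : List Letter) : xiW k (v ++ w) = xiW k v ++ xiW k w := by
  simp [xiW]

lemma xiW_singleton (k : ℕ) (a : Letter) : xiW k [a] = xiL k a := by
  simp [xiW]

lemma iterate_xiW_append (k n : ℕ) (v w : List Letter) :
    (xiW k)^[n] (v ++ w) = (xiW k)^[n] v ++ (xiW k)^[n] w := by
  induction n with
  | zero => rfl
  | succ n ih => simp only [Function.iterate_succ_apply', ih, xiW_append]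

lemma exists_xiW_concat {k : ℕ} (hk : 4 ≤ k) (v : List Letter) (a : Letter) :
    ∃ q, xiW k (v ++ [a]) = q ++ [lam k a] := by
  obtain ⟨q, hq⟩ := exists_xiL_eq hk a
  exact ⟨xiW k v ++ q, by rw [xiW_append, xiW_singleton, hq, List.append_assoc]⟩

lemma exists_iterate_xiW_concat {k : ℕ} (hk : 4 ≤ k) (n : ℕ) (v : List Letter) (a : Letter) :
    ∃ q, (xiW k)^[n] (v ++ [a]) = q ++ [(lam k)^[n] a] := by
  induction n with
  | zero => exact ⟨v, rfl⟩
  | succ n ih =>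
    obtain ⟨q, hq⟩ := ih
    rw [Function.iterate_succ_apply', Function.iterate_succ_apply', hq]
    exact exists_xiW_concat hk q _

lemma head_xiW_snd_ne_one (k : ℕ) (v : List Letter) : ∀ y ∈ (xiW k v).head?, y.2 ≠ 1 := by
  cases v with
  | nil => simp
  | cons a v =>
    obtain ⟨q, hq⟩ := exists_xiL_eq_cons k a
    simp only [xiW_cons, hq, List.cons_append, List.head?_cons, Option.mem_def, Option.some.injEq]
    rintro y rfl
    exact hd_snd_ne_one k a

lemma xiW_injective {k : ℕ} (hk : 4 ≤ k) : Function.Injective (xiW k) := by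
  intro v
  induction v using List.reverseRecOn with
  | nil =>
    intro w h
    cases w with
    | nil => rfl
    | cons a w =>
      obtain ⟨q, hq⟩ := exists_xiL_eq_cons k a
      simp [xiW_cons, hq] at h
  | append_singleton v a ih =>
    intro w h
    induction w using List.reverseRecOn with
    | nil =>
      obtain ⟨q, hq⟩ := exists_xiW_concat hk v a
      simp [hq] at h
    | append_singleton w b _ =>
      obtain ⟨q, hq⟩ := exists_xiW_concat hk v a
      obtain ⟨r, hr⟩ := exists_xiW_concat hk w b
      have hab : a = b := by
        have h' := h
        simp only [hq, hr] at h'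
        exact lam_injective k (by simpa using (List.append_inj' h' rfl).2)
      subst hab
      simp only [xiW_append] at h
      rw [ih (List.append_cancel_right h)]

lemma length_le_length_xiW (k : ℕ) (v : List Letter) : v.length ≤ (xiW k v).length := by
  induction v with
  | nil => simp
  | cons a v ih =>
    obtain ⟨q, hq⟩ := exists_xiL_eq_cons k a
    simp [xiW_cons, hq]
    omega

lemma length_lt_length_xiW (k : ℕ) (s : Bool) (v : List Letter) :
    ((s, 0) :: v).length < (xiW k ((s, 0) :: v)).length := by
  have := length_le_length_xiW k v
  simp [xiW_cons, xiL_zero]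
  omega

lemma xiW_eq_append {k : ℕ} {V X Y : List Letter} (h : xiW k V = X ++ Y)
    (hY : ∀ y ∈ Y.head?, y.2 ≠ 1) :
    ∃ V₁ V₂, V = V₁ ++ V₂ ∧ xiW k V₁ = X ∧ xiW k V₂ = Y := by
  induction V generalizing X with
  | nil =>
    simp at h
    exact ⟨[], [], by simp [h]⟩
  | cons a V ih =>
    rcases X with _ | ⟨x, X⟩
    · exact ⟨[], a :: V, by simp, rfl, h⟩
    rw [xiW_cons] at h
    by_cases ha : a.2 = 0
    · obtain ⟨s, i⟩ := a
      simp only at ha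
      subst ha
      simp only [xiL_zero, List.cons_append, List.cons.injEq, List.nil_append] at h
      obtain ⟨rfl, h⟩ := h
      rcases X with _ | ⟨x', X⟩
      · simp only [List.nil_append] at h
        subst h
        exact absurd rfl (hY (s, 1) (by simp))
      · simp only [List.cons_append, List.cons.injEq] at h
        obtain ⟨rfl, h⟩ := h
        obtain ⟨V₁, V₂, rfl, rfl, h₂⟩ := ih h
        exact ⟨(s, 0) :: V₁, V₂, by simp, by simp [xiW_cons, xiL_zero], h₂⟩
    · simp only [xiL_eq_single ha, List.cons_append, List.cons.injEq, List.nil_append] at h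
      obtain ⟨rfl, h⟩ := h
      obtain ⟨V₁, V₂, rfl, rfl, h₂⟩ := ih h
      exact ⟨a :: V₁, V₂, by simp, by simp [xiW_cons, xiL_eq_single ha], h₂⟩

/-! ### The words `ξ^n(0)` -/

lemma xiPow_eq (k n : ℕ) : xiPow k n = zeroPow k false n := rfl

lemma zeroPow_succ' (k : ℕ) (s : Bool) (n : ℕ) :
    zeroPow k s (n + 1) = xiW k (zeroPow k s n) := by
  rw [zeroPow, Function.iterate_succ_apply']; rfl

lemma iterate_zeroPow (k : ℕ) (s : Bool) (m n : ℕ) :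
    (xiW k)^[m] (zeroPow k s n) = zeroPow k s (m + n) := by
  rw [zeroPow, zeroPow, Function.iterate_add_apply]

lemma zeroPow_succ (k : ℕ) (s : Bool) (n : ℕ) :
    zeroPow k s (n + 1) = zeroPow k s n ++ (xiW k)^[n] [(s, 1)] := by
  rw [zeroPow, Function.iterate_succ_apply, xiW_singleton, xiL_zero, zeroPow,
    ← iterate_xiW_append]
  rfl

lemma iterate_xiW_one {k i : ℕ} (s : Bool) (hi : i + 1 < k) :
    (xiW k)^[i] [(s, 1)] = [(s, i + 1)] := by
  induction i with
  | zero => rfl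
  | succ i ih =>
    rw [Function.iterate_succ_apply', ih (by omega), xiW_singleton, xiL_eq_single (by simp), lam,
      if_neg (by simp; omega)]

lemma zeroPow_succ_of_lt {k i : ℕ} (s : Bool) (hi : i + 1 < k) :
    zeroPow k s (i + 1) = zeroPow k s i ++ [(s, i + 1)] := by
  rw [zeroPow_succ, iterate_xiW_one s hi]

lemma zeroPow_add_k {k : ℕ} (hk : 4 ≤ k) (s : Bool) (n : ℕ) :
    zeroPow k s (n + k) = zeroPow k s (n + (k - 1)) ++ zeroPow k (!s) n := by
  obtain ⟨m, rfl⟩ : ∃ m, k = m + 2 := ⟨k - 2, by omega⟩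
  have h : n + (m + 2) = n + (m + 1) + 1 := by omega
  rw [h, zeroPow_succ, Function.iterate_add_apply, Function.iterate_succ_apply',
    iterate_xiW_one s (by omega), xiW_singleton, xiL_eq_single (by simp), lam, if_pos (by simp)]
  rfl

lemma exists_zeroPow_eq_cons (k : ℕ) (s : Bool) (n : ℕ) : ∃ q, zeroPow k s n = (s, 0) :: q := by
  induction n with
  | zero => exact ⟨[], rfl⟩
  | succ n ih =>
    obtain ⟨q, hq⟩ := ih
    exact ⟨(s, 1) :: xiW k q, by simp [zeroPow_succ', hq, xiW_cons, xiL_zero]⟩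

lemma length_zeroPow_lt (k : ℕ) (s : Bool) (n : ℕ) :
    (zeroPow k s n).length < (zeroPow k s (n + 1)).length := by
  obtain ⟨q, hq⟩ := exists_zeroPow_eq_cons k s n
  rw [zeroPow_succ', hq]
  exact length_lt_length_xiW k s q

lemma length_zeroPow_strictMono (k : ℕ) (s : Bool) :
    StrictMono fun n => (zeroPow k s n).length :=
  strictMono_nat_of_lt_succ (length_zeroPow_lt k s)

lemma map_twin_xiW (k : ℕ) (w : List Letter) : (xiW k w).map twin = xiW k (w.map twin) := by
  induction w with
  | nil => rfl
  | cons a w ih =>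
    have h : (xiL k a).map twin = xiL k (twin a) := by
      unfold xiL twin
      split_ifs <;> simp
    rw [xiW_cons, List.map_append, ih, h, List.map_cons, xiW_cons]

lemma map_twin_zeroPow (k : ℕ) (s : Bool) (n : ℕ) :
    (zeroPow k s n).map twin = zeroPow k (!s) n := by
  induction n with
  | zero => rfl
  | succ n ih => rw [zeroPow_succ', map_twin_xiW, ih, zeroPow_succ']

/-! ### The language -/

lemma xiPow_prefix_succ (k n : ℕ) : xiPow k n <+: xiPow k (n + 1) := by
  rw [xiPow_eq, xiPow_eq, zeroPow_succ]
  exact List.prefix_append _ _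

lemma factorOf_iff {k : ℕ} {u : ℕ → Letter} (hu : IsFixedPoint k u) (w : List Letter) :
    FactorOf w u ↔ InL k w := by
  constructor
  · rintro ⟨j, hj⟩
    have hlen : j + w.length ≤ (xiPow k (j + w.length)).length :=
      (length_zeroPow_strictMono k false).le_apply
    refine ⟨j + w.length, ?_⟩
    have hw : w = ((xiPow k (j + w.length)).drop j).take w.length := by
      refine List.ext_getElem? fun i => ?_
      rw [List.getElem?_take]
      split_ifs with hi
      · rw [hj i hi, List.getElem?_drop, hu _ _ (by omega), zero_add]
      · exact List.getElem?_eq_none (by omega)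
    have h := (List.take_prefix w.length ((xiPow k (j + w.length)).drop j)).isInfix.trans
      (List.drop_suffix _ _).isInfix
    rwa [← hw] at h
  · rintro ⟨n, s, t, h⟩
    refine ⟨s.length, fun i hi => ?_⟩
    have h' := hu n (s.length + i) (by rw [← h]; simp; omega)
    rw [← h, zero_add] at h'
    rw [← h', List.append_assoc, List.getElem?_append_right (by omega),
      List.getElem?_append_left (by omega)]
    congr 1
    omega

lemma InL.of_infix {k : ℕ} {v w : List Letter} (hw : InL k w) (h : v <:+: w) : InL k v :=
  hw.imp fun _ hn => h.trans hn

lemma InL.left {k : ℕ} {v w : List Letter} (h : InL k (v ++ w)) : InL k v :=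
  h.of_infix (List.prefix_append _ _).isInfix

lemma InL.right {k : ℕ} {v w : List Letter} (h : InL k (v ++ w)) : InL k w :=
  h.of_infix (List.suffix_append _ _).isInfix

lemma InL.image {k : ℕ} {w : List Letter} (h : InL k w) : InL k (xiW k w) := by
  obtain ⟨n, s, t, h⟩ := h
  refine ⟨n + 1, xiW k s, xiW k t, ?_⟩
  rw [← xiW_append, ← xiW_append, h]
  exact (zeroPow_succ' k false n).symm

lemma InL.iterate {k : ℕ} {w : List Letter} (h : InL k w) (n : ℕ) : InL k ((xiW k)^[n] w) := by
  induction n with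
  | zero => exact h
  | succ n ih => rw [Function.iterate_succ_apply']; exact ih.image

lemma InL.exists_infix_xiW {k : ℕ} {w : List Letter} (h : InL k w) :
    ∃ V, InL k V ∧ w <:+: xiW k V := by
  obtain ⟨n, h⟩ := h
  refine ⟨xiPow k n, ⟨n, List.infix_rfl⟩, ?_⟩
  have := h.trans (xiPow_prefix_succ k n).isInfix
  rwa [xiPow_eq, zeroPow_succ'] at this

lemma InL.exists_concat {k : ℕ} {w : List Letter} (h : InL k w) : ∃ z, InL k (w ++ [z]) := by
  obtain ⟨n, s, t, h⟩ := h
  obtain ⟨r, hr⟩ := xiPow_prefix_succ k n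
  rcases hz : t ++ r with _ | ⟨z, q⟩
  · have hr0 : r = [] := (List.append_eq_nil_iff.1 hz).2
    have hlt : (xiPow k n).length < (xiPow k (n + 1)).length := length_zeroPow_lt k false n
    rw [← hr, hr0] at hlt
    simp at hlt
  · refine ⟨z, n + 1, s, q, ?_⟩
    rw [← hr, ← h]
    simp [hz]

lemma InL.snd_lt {k : ℕ} (hk : 4 ≤ k) {w : List Letter} (h : InL k w) {a : Letter} (ha : a ∈ w) :
    a.2 < k := by
  obtain ⟨n, h⟩ := h
  replace ha := h.subset ha
  clear h
  rw [xiPow_eq] at ha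
  induction n generalizing a with
  | zero => simp [zeroPow] at ha; subst ha; simp; omega
  | succ n ih =>
    rw [zeroPow_succ', xiW, List.mem_flatMap] at ha
    obtain ⟨b, hb, hab⟩ := ha
    have hbk := ih hb
    unfold xiL at hab
    split_ifs at hab <;> simp at hab <;> grind

lemma isChain_xiW {k : ℕ} (hk : 4 ≤ k) {V : List Letter} (hV : ∀ a ∈ V, a.2 < k)
    (h : V.IsChain fun x y => y.2 ≠ 0 → x = (y.1, y.2 - 1)) :
    (xiW k V).IsChain fun x y => y.2 ≠ 0 → x = (y.1, y.2 - 1) := by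
  induction V with
  | nil => simp
  | cons c V ih =>
    rw [xiW_cons, List.isChain_append]
    refine ⟨?_, ih (fun a ha => hV a (by simp [ha])) h.tail, ?_⟩
    · unfold xiL
      split_ifs <;> simp
    · intro x hx y hy hy0
      obtain ⟨q, hq⟩ := exists_xiL_eq hk c
      simp only [hq, List.getLast?_append, List.getLast?_singleton, Option.some_or,
        Option.mem_def, Option.some.injEq] at hx
      subst hx
      cases V with
      | nil => simp at hy
      | cons d V =>
        obtain ⟨r, hr⟩ := exists_xiL_eq_cons k d
        simp only [xiW_cons, hr, List.cons_append, List.head?_cons, Option.mem_def,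
          Option.some.injEq] at hy
        subst hy
        have hcd := (List.isChain_cons_cons.1 h).1
        have hd := hV d (by simp)
        obtain ⟨c, i⟩ := c
        obtain ⟨d, j⟩ := d
        unfold _root_.hd lam at *
        grind

lemma InL.eq_pred {k : ℕ} (hk : 4 ≤ k) {p : List Letter} {x y : Letter} (h : InL k (p ++ [x, y]))
    (hy : y.2 ≠ 0) : x = (y.1, y.2 - 1) := by
  have hch : ∀ n, (xiPow k n).IsChain fun x y => y.2 ≠ 0 → x = (y.1, y.2 - 1) := by
    intro n
    induction n with
    | zero => simp [xiPow]
    | succ n ih =>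
      rw [xiPow_eq, zeroPow_succ']
      exact isChain_xiW hk (fun a ha => InL.snd_lt hk ⟨n, List.infix_rfl⟩ ha) ih
  obtain ⟨n, hn⟩ := h.right
  exact (List.isChain_pair.1 ((hch n).infix hn)) hy

/-! ### Desubstitution -/

lemma exists_of_append_eq_xiW {k : ℕ} {V s w t : List Letter} {z : Letter}
    (h : s ++ (w ++ z :: t) = xiW k V) (hw : ∀ y ∈ (w ++ [z]).head?, y.2 ≠ 1) (hz : z.2 ≠ 1) :
    ∃ V₁ v c V₂, V = V₁ ++ (v ++ c :: V₂) ∧ xiW k V₁ = s ∧ xiW k v = w ∧ hd k c = z := by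
  have hw' : ∀ y ∈ (w ++ z :: t).head?, y.2 ≠ 1 := by
    intro y hy
    apply hw
    cases w <;> simpa using hy
  obtain ⟨V₁, V', rfl, h₁, h'⟩ := xiW_eq_append h.symm hw'
  obtain ⟨v, V₂, rfl, h₂, h₃⟩ := xiW_eq_append h' (by simpa using hz)
  cases V₂ with
  | nil => simp at h₃
  | cons c V₂ =>
    obtain ⟨q, hq⟩ := exists_xiL_eq_cons k c
    rw [xiW_cons, hq, List.cons_append, List.cons.injEq] at h₃
    exact ⟨V₁, v, c, V₂, rfl, h₁, h₂, h₃.1⟩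

/-- Desubstitution of a factor with a given right context and at most one letter of left
context. -/
lemma InL.desubst {k : ℕ} (hk : 4 ≤ k) {p w : List Letter} {z : Letter} (hp : p.length ≤ 1)
    (h : InL k (p ++ (w ++ [z]))) (hw : ∀ y ∈ (w ++ [z]).head?, y.2 ≠ 1) (hz : z.2 ≠ 1) :
    ∃ p' v c, p'.map (lam k) = p ∧ xiW k v = w ∧ hd k c = z ∧ InL k (p' ++ (v ++ [c])) := by
  obtain ⟨V, hV, s, t, hst⟩ := h.exists_infix_xiW
  obtain ⟨V₁, v, c, V₂, rfl, h₁, h₂, h₃⟩ :=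
    exists_of_append_eq_xiW (s := s ++ p) (t := t) (by simpa using hst) hw hz
  rcases p with _ | ⟨a, _ | ⟨b, p⟩⟩
  · exact ⟨[], v, c, rfl, h₂, h₃, hV.of_infix ⟨V₁, V₂, by simp⟩⟩
  · rcases V₁.eq_nil_or_concat' with rfl | ⟨V₁, d, rfl⟩
    · simp at h₁
    · obtain ⟨q, hq⟩ := exists_xiW_concat hk V₁ d
      rw [hq] at h₁
      exact ⟨[d], v, c, (List.append_inj' h₁ rfl).2, h₂, h₃, hV.of_infix ⟨V₁, V₂, by simp⟩⟩
  · simp at hp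

lemma InL.desubst_xiW {k : ℕ} (hk : 4 ≤ k) {p x : List Letter} {z : Letter} (hp : p.length ≤ 1)
    (h : InL k (p ++ (xiW k x ++ [z]))) (hz : z.2 ≠ 1) :
    ∃ p' c, p'.map (lam k) = p ∧ hd k c = z ∧ InL k (p' ++ (x ++ [c])) := by
  obtain ⟨p', v, c, h₁, h₂, h₃, h₄⟩ := h.desubst hk hp (by
    have := head_xiW_snd_ne_one k x
    cases hx : xiW k x <;> simp_all) hz
  rw [xiW_injective hk h₂] at h₄
  exact ⟨p', c, h₁, h₃, h₄⟩

lemma InL.desubst_concat {k : ℕ} (hk : 4 ≤ k) {p x : List Letter} {l : Letter} (hp : p.length ≤ 1)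
    (h : InL k (p ++ xiW k (x ++ [l]))) (hl : l.2 ≠ k - 1) :
    ∃ p', p'.map (lam k) = p ∧ InL k (p' ++ (x ++ [l])) := by
  obtain ⟨z, hz⟩ := h.exists_concat
  have hz1 : z.2 ≠ 1 := by
    intro hz1
    obtain ⟨q, hq⟩ := exists_xiW_concat hk x l
    have := InL.eq_pred (p := p ++ q) (x := lam k l) (y := z) hk (by simpa [hq] using hz) (by omega)
    simp [lam, hl, hz1] at this
  obtain ⟨p', c, h₁, -, h₂⟩ := InL.desubst_xiW hk hp (by simpa using hz) hz1
  exact ⟨p', h₁, InL.left (w := [c]) (by simpa using h₂)⟩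

lemma InL.desubst_zero {k : ℕ} (hk : 4 ≤ k) {p x : List Letter} {l : Letter} {s : Bool}
    (hp : p.length ≤ 1) (h : InL k (p ++ (xiW k (x ++ [l]) ++ [(s, 0)])))
    (hl : l ≠ (!s, k - 2)) :
    ∃ p', p'.map (lam k) = p ∧ InL k (p' ++ (x ++ [l] ++ [(s, 0)])) := by
  obtain ⟨p', c, h₁, h₂, h₃⟩ := h.desubst_xiW hk hp (by simp)
  rcases eq_of_hd_zero h₂ with rfl | rfl
  · exact ⟨p', h₁, h₃⟩
  · refine absurd ?_ hl
    have := InL.eq_pred (p := p' ++ x) (x := l) (y := (!s, k - 1)) hk (by simpa using h₃)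
      (by simp; omega)
    rw [this]
    rfl

lemma InL.desubst_iterate {k : ℕ} (hk : 4 ≤ k) {p x : List Letter} {s : Bool} {j : ℕ}
    (hp : p.length ≤ 1) (hj : j < k) (h : InL k (p ++ (xiW k)^[j] (x ++ [(s, 0)]))) :
    ∃ p', p'.map ((lam k)^[j]) = p ∧ InL k (p' ++ (x ++ [(s, 0)])) := by
  induction j generalizing p with
  | zero => exact ⟨p, by simp, h⟩
  | succ j ih =>
    obtain ⟨q, hq⟩ := exists_iterate_xiW_concat hk j x (s, 0)
    rw [Function.iterate_succ_apply', hq, lam_iterate_lt s (by omega)] at h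
    obtain ⟨p₁, rfl, h₁⟩ := h.desubst_concat hk hp (by simp; omega)
    rw [← lam_iterate_lt (k := k) s (by omega), ← hq] at h₁
    obtain ⟨p₂, rfl, h₂⟩ := ih (by simpa using hp) (by omega) h₁
    exact ⟨p₂, by rw [List.map_map, ← Function.iterate_succ'], h₂⟩

lemma InL.desubst_iterate_zero {k : ℕ} (hk : 4 ≤ k) {p x : List Letter} {s t : Bool} {j : ℕ}
    (hp : p.length ≤ 1) (hj : ∀ i < j, (lam k)^[i] (s, 0) ≠ (!t, k - 2))
    (h : InL k (p ++ ((xiW k)^[j] (x ++ [(s, 0)]) ++ [(t, 0)]))) :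
    ∃ p', p'.map ((lam k)^[j]) = p ∧ InL k (p' ++ (x ++ [(s, 0)] ++ [(t, 0)])) := by
  induction j generalizing p with
  | zero => exact ⟨p, by simp, h⟩
  | succ j ih =>
    obtain ⟨q, hq⟩ := exists_iterate_xiW_concat hk j x (s, 0)
    rw [Function.iterate_succ_apply', hq] at h
    obtain ⟨p₁, rfl, h₁⟩ := h.desubst_zero hk hp (hj j (by omega))
    rw [← hq] at h₁
    obtain ⟨p₂, rfl, h₂⟩ := ih (by simpa using hp) (fun i hi => hj i (by omega)) h₁
    exact ⟨p₂, by rw [List.map_map, ← Function.iterate_succ'], h₂⟩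

lemma InL.eq_of_zero_zero {k : ℕ} (hk : 4 ≤ k) {x : Letter} {s t : Bool}
    (h : InL k [x, (s, 0), (t, 0)]) : x = (!s, k - 1) := by
  obtain ⟨p', v, c, h₁, h₂, -, h₄⟩ :=
    InL.desubst (p := [x]) (w := [(s, 0)]) (z := (t, 0)) hk (by simp) h (by simp) (by simp)
  obtain ⟨y, rfl, rfl⟩ : ∃ y, p' = [y] ∧ lam k y = x := by
    rcases p' with _ | ⟨y, _ | _⟩ <;> simp_all
  have hv : v = [(!s, k - 1)] := by
    refine xiW_injective hk (h₂.trans ?_)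
    rw [xiW_singleton, xiL_eq_single (by simp; omega)]
    simp [lam]
  subst hv
  have := InL.eq_pred (p := []) (x := y) (y := (!s, k - 1)) hk
    (InL.left (w := [c]) (by simpa using h₄)) (by simp; omega)
  subst this
  simp only [lam]
  rw [if_neg (by omega)]
  congr 1
  omega

/-! ### The bispecial words -/

/-- The word `ξ^{n+2k-1}(0)ξ^n(0)` or its twin. -/
def pairPow (k : ℕ) (s : Bool) (n : ℕ) : List Letter :=
  zeroPow k s (n + (2 * k - 1)) ++ zeroPow k s n

lemma pairPow_succ (k : ℕ) (s : Bool) (n : ℕ) : pairPow k s (n + 1) = xiW k (pairPow k s n) := by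
  rw [pairPow, pairPow, xiW_append, ← zeroPow_succ', ← zeroPow_succ']
  congr 2
  omega

lemma pairPow_zero (k : ℕ) (s : Bool) : pairPow k s 0 = zeroPow k s (2 * k - 1) ++ [(s, 0)] := by
  simp [pairPow, zeroPow]

lemma zeroPow_concat_eq_iterate {k : ℕ} (hk : 4 ≤ k) (s : Bool) :
    zeroPow k s (2 * k - 2) ++ [(!s, k - 1)] =
      (xiW k)^[k - 1] (zeroPow k s (k - 2) ++ [(!s, 0)]) := by
  have h₁ : 2 * k - 2 = k - 2 + k := by omega
  have h₂ : zeroPow k (!s) (k - 1) = zeroPow k (!s) (k - 2) ++ [(!s, k - 1)] := by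
    have := zeroPow_succ_of_lt (k := k) (i := k - 2) (!s) (by omega)
    rwa [show k - 2 + 1 = k - 1 by omega] at this
  rw [iterate_xiW_append, iterate_zeroPow, h₁, zeroPow_add_k hk, List.append_assoc, ← h₂,
    Nat.add_comm]
  rfl

lemma zeroPow_two_mul_sub_one {k : ℕ} (hk : 4 ≤ k) (s : Bool) :
    zeroPow k s (2 * k - 1) = xiW k (zeroPow k s (2 * k - 2)) := by
  rw [← zeroPow_succ']
  congr 1
  omega

lemma pairPow_zero_eq_image {k : ℕ} (hk : 4 ≤ k) (s : Bool) :
    pairPow k s 0 = xiW k (zeroPow k s (2 * k - 2) ++ [(!s, k - 1)]) := by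
  rw [xiW_append, ← zeroPow_two_mul_sub_one hk, xiW_singleton, xiL_eq_single (by simp; omega),
    pairPow_zero]
  simp [lam]

lemma pairPow_zero_eq_iterate {k : ℕ} (hk : 4 ≤ k) (s : Bool) :
    pairPow k s 0 = (xiW k)^[k] (zeroPow k s (k - 2) ++ [(!s, 0)]) := by
  rw [pairPow_zero_eq_image hk, zeroPow_concat_eq_iterate hk, ← Function.iterate_succ_apply' (xiW k)]
  congr 2
  omega

lemma exists_zeroPow_eq_concat {k i : ℕ} (hk : 4 ≤ k) (s : Bool) (hi : i < k) :
    ∃ q, zeroPow k s i = q ++ [(s, i)] := by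
  obtain ⟨q, hq⟩ := exists_iterate_xiW_concat hk i [] (s, 0)
  exact ⟨q, by rw [lam_iterate_lt s hi] at hq; exact hq⟩

lemma not_inL_pairPow_zero_concat {k : ℕ} (hk : 4 ≤ k) (s : Bool) :
    ¬ InL k (pairPow k s 0 ++ [(!s, 0)]) := by
  intro h
  rw [pairPow_zero_eq_iterate hk] at h
  obtain ⟨p, hp, h⟩ := InL.desubst_iterate_zero (p := []) hk (by simp) (fun i hi => by
    rw [lam_iterate_lt _ hi]
    simp) h
  obtain ⟨q, hq⟩ := exists_zeroPow_eq_concat hk s (i := k - 2) (by omega)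
  rw [hq] at h
  have := InL.eq_of_zero_zero (x := (s, k - 2)) (s := !s) (t := !s) hk
    (InL.right (v := p ++ q) (by simpa using h))
  simp at this
  omega

/-- The shape of a bispecial word, together with restrictions on its right extensions. -/
def BispecialShape (k : ℕ) (w : List Letter) : Prop :=
  ∃ s n,
    (w = zeroPow k s n ∧ ∀ z, InL k (w ++ [z]) →
      z.2 = 0 ∨ (n ≤ 2 * k - 2 ∧ n ≠ k - 1 ∧ z = (lam k)^[n + 1] (s, 0))) ∨
    (w = pairPow k s n ∧ ∀ z, InL k (w ++ [z]) →
      (n ≤ k - 2 ∧ (z = (s, 0) ∨ z = (s, n + 1))) ∨ (k - 1 ≤ n ∧ z.2 = 0))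

lemma lam_iterate_two_k {k i : ℕ} (hk : 4 ≤ k) (s : Bool) (h₁ : i ≤ 2 * k) :
    (i < k ∧ (lam k)^[i] (s, 0) = (s, i)) ∨
      (k ≤ i ∧ i < 2 * k ∧ (lam k)^[i] (s, 0) = (!s, i - k)) ∨
      (i = 2 * k ∧ (lam k)^[i] (s, 0) = (s, 0)) := by
  rcases lt_or_ge i k with h | h
  · exact Or.inl ⟨h, lam_iterate_lt s h⟩
  obtain ⟨j, rfl⟩ := Nat.exists_eq_add_of_le' h
  rw [lam_iterate_add_k hk]
  rcases lt_or_ge j k with h | h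
  · exact Or.inr (Or.inl ⟨by omega, by omega, by rw [lam_iterate_lt _ h]; simp⟩)
  · obtain rfl : j = k := by omega
    exact Or.inr (Or.inr ⟨by omega, by rw [lam_iterate_k hk]; simp⟩)

lemma BispecialShape.image {k : ℕ} (hk : 4 ≤ k) {v : List Letter} (hv : BispecialShape k v)
    (h : ∀ z, InL k (xiW k v ++ [z]) → ∃ c, hd k c = z ∧ InL k (v ++ [c])) :
    BispecialShape k (xiW k v) := by
  obtain ⟨s, n, ⟨rfl, hz⟩ | ⟨rfl, hz⟩⟩ := hv
  · refine ⟨s, n + 1, Or.inl ⟨(zeroPow_succ' k s n).symm, fun z h' => ?_⟩⟩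
    obtain ⟨c, rfl, hc⟩ := h z h'
    rcases hz c hc with hc | ⟨h₁, h₂, rfl⟩
    · left
      simp [hd, hc]
    · have h₃ : ((lam k)^[n + 1] (s, 0)).2 ≠ 0 := by
        rcases lam_iterate_two_k (i := n + 1) hk s (by omega) with h | h | h <;>
          grind
      rw [hd, if_neg h₃, ← Function.iterate_succ_apply' (lam k)]
      by_cases h₄ : n + 1 ≤ 2 * k - 2 ∧ n + 1 ≠ k - 1
      · exact Or.inr ⟨h₄.1, h₄.2, rfl⟩
      · left
        rcases lam_iterate_two_k (i := n + 2) hk s (by omega) with h | h | h <;>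
          grind
  · refine ⟨s, n + 1, Or.inr ⟨(pairPow_succ k s n).symm, fun z h' => ?_⟩⟩
    obtain ⟨c, rfl, hc⟩ := h z h'
    rcases hz c hc with ⟨h₁, rfl | rfl⟩ | ⟨h₁, h₂⟩
    · simp only [hd, if_true]
      grind
    · simp only [hd, lam]
      grind
    · rw [hd, if_pos h₂]
      exact Or.inr ⟨by omega, h₂⟩

lemma BispecialShape.eq_of_extensions {k : ℕ} (hk : 4 ≤ k) {v : List Letter}
    (hv : BispecialShape k v) {s : Bool} (h₁ : InL k (v ++ [(s, 0)]))
    (h₂ : InL k (v ++ [(!s, k - 1)])) :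
    v = zeroPow k (!s) (k - 2) ∨ v = zeroPow k s (2 * k - 2) := by
  obtain ⟨t, n, ⟨rfl, hz⟩ | ⟨rfl, hz⟩⟩ := hv
  · rcases hz _ h₂ with h | ⟨h₃, h₄, h₅⟩
    · simp at h
      omega
    · rcases lam_iterate_two_k (i := n + 1) hk t (by omega) with h | h | h
      · left
        obtain rfl : n = k - 2 := by grind
        obtain rfl : t = !s := by grind
        rfl
      · right
        obtain rfl : n = 2 * k - 2 := by grind
        obtain rfl : t = s := by cases s <;> cases t <;> grind
        rfl
      · omega
  · have h₃ := hz _ h₁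
    have h₄ := hz _ h₂
    exfalso
    cases s <;> cases t <;> grind

/-- Left special words with respect to the language `InL`. -/
def LSpecial (k : ℕ) (w : List Letter) : Prop := ∃ a b, a ≠ b ∧ InL k (a :: w) ∧ InL k (b :: w)

/-- Right special words with respect to the language `InL`. -/
def RSpecial (k : ℕ) (w : List Letter) : Prop :=
  ∃ a b, a ≠ b ∧ InL k (w ++ [a]) ∧ InL k (w ++ [b])

lemma LSpecial.exists_eq_cons {k : ℕ} (hk : 4 ≤ k) {w : List Letter} (h : LSpecial k w)
    (hw : w ≠ []) : ∃ s q, w = (s, 0) :: q := by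
  obtain ⟨a, b, hab, ha, hb⟩ := h
  obtain ⟨⟨s, i⟩, q, rfl⟩ := List.exists_cons_of_ne_nil hw
  by_cases hi : i = 0
  · exact ⟨s, q, by rw [hi]⟩
  · refine absurd ?_ hab
    rw [InL.eq_pred (p := []) (x := a) (y := (s, i)) hk (InL.left (w := q) ha) hi,
      InL.eq_pred (p := []) (x := b) (y := (s, i)) hk (InL.left (w := q) hb) hi]

lemma LSpecial.of_forall {k : ℕ} {v w : List Letter} (h : LSpecial k w)
    (hvw : ∀ a, InL k (a :: w) → ∃ d, lam k d = a ∧ InL k (d :: v)) : LSpecial k v := by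
  obtain ⟨a, b, hab, ha, hb⟩ := h
  obtain ⟨c, rfl, hc⟩ := hvw a ha
  obtain ⟨d, rfl, hd⟩ := hvw b hb
  exact ⟨c, d, fun h => hab (by rw [h]), hc, hd⟩

lemma exists_of_map_eq_singleton {k n : ℕ} {p : List Letter} {a : Letter}
    (h : p.map ((lam k)^[n]) = [a]) : ∃ d, p = [d] ∧ (lam k)^[n] d = a := by
  rcases p with _ | ⟨d, _ | _⟩ <;> simp_all

lemma InL.desubst_cons {k : ℕ} (hk : 4 ≤ k) {x : List Letter} {a z : Letter}
    (h : InL k (a :: xiW k x ++ [z])) (hz : z.2 ≠ 1) :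
    ∃ d c, lam k d = a ∧ hd k c = z ∧ InL k (d :: x ++ [c]) := by
  obtain ⟨p, c, h₁, h₂, h₃⟩ := InL.desubst_xiW (p := [a]) hk (by simp) (by simpa using h) hz
  obtain ⟨d, rfl, h₄⟩ := exists_of_map_eq_singleton (n := 1) h₁
  exact ⟨d, c, h₄, h₂, by simpa using h₃⟩

lemma InL.desubst_cons_concat {k : ℕ} (hk : 4 ≤ k) {x : List Letter} {a l : Letter}
    (h : InL k (a :: xiW k (x ++ [l]))) (hl : l.2 ≠ k - 1) :
    ∃ d, lam k d = a ∧ InL k (d :: (x ++ [l])) := by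
  obtain ⟨p, h₁, h₃⟩ := InL.desubst_concat (p := [a]) hk (by simp) (by simpa using h) hl
  obtain ⟨d, rfl, h₄⟩ := exists_of_map_eq_singleton (n := 1) h₁
  exact ⟨d, h₄, by simpa using h₃⟩

lemma eq_or_of_inL_concat_zero {k : ℕ} (hk : 4 ≤ k) {w : List Letter} {s : Bool} {z : Letter}
    (h : InL k (w ++ [(s, 0)] ++ [z])) : z.2 = 0 ∨ z = (s, 1) := by
  by_cases hz : z.2 = 0
  · exact Or.inl hz
  · right
    have := InL.eq_pred (p := w) (x := (s, 0)) (y := z) hk (by simpa using h) hz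
    obtain ⟨t, i⟩ := z
    simp at this hz ⊢
    exact ⟨this.1.symm, by omega⟩

/-- A bispecial word ending in a zero which can be followed by a one comes from a bispecial word
that is followed by two letters whose images begin with this zero. -/
lemma exists_xiW_eq_of_concat_one {k : ℕ} (hk : 4 ≤ k) {w : List Letter} {s : Bool}
    (hw : ∃ t q, w = (t, 0) :: q) (hl : LSpecial k (w ++ [(s, 0)]))
    (hr : RSpecial k (w ++ [(s, 0)])) (h₁ : InL k (w ++ [(s, 0)] ++ [(s, 1)])) :
    ∃ v, xiW k v = w ∧ LSpecial k v ∧ InL k (v ++ [(s, 0)]) ∧ InL k (v ++ [(!s, k - 1)]) := by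
  have hs : xiW k [(!s, k - 1)] = [(s, 0)] := by
    rw [xiW_singleton, xiL_eq_single (by simp; omega)]
    simp [lam]
  obtain ⟨b, hb0, hb⟩ : ∃ b : Letter, b.2 = 0 ∧ InL k (w ++ [(s, 0)] ++ [b]) := by
    obtain ⟨a, b, hab, ha, hb⟩ := hr
    rcases eq_or_of_inL_concat_zero hk ha with h | h
    · exact ⟨a, h, ha⟩
    · rcases eq_or_of_inL_concat_zero hk hb with h' | h'
      · exact ⟨b, h', hb⟩
      · exact absurd (h.trans h'.symm) hab
  have hhead : ∀ y ∈ (w ++ [(s, 0)]).head?, y.2 ≠ 1 := by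
    obtain ⟨t, q, rfl⟩ := hw
    simp
  obtain ⟨p, v, c, hp, rfl, hc, h₂⟩ :=
    InL.desubst (p := []) (w := w) (z := (s, 0)) hk (by simp) (InL.left (w := [b]) hb) hhead (by simp)
  have h10 : xiW k v ++ [(s, 0)] ++ [(s, 1)] = xiW k (v ++ [(s, 0)]) := by
    rw [xiW_append, xiW_singleton, xiL_zero]
    simp
  have hk1 : xiW k v ++ [(s, 0)] = xiW k (v ++ [(!s, k - 1)]) := by
    rw [xiW_append, hs]
  refine ⟨v, rfl, ?_, ?_, ?_⟩
  · refine hl.of_forall fun a ha => ?_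
    obtain ⟨z, hz⟩ := ha.exists_concat
    rcases eq_or_of_inL_concat_zero (w := a :: xiW k v) hk hz with h | rfl
    · rw [hk1] at hz
      obtain ⟨d, c', h₃, -, h₄⟩ := InL.desubst_cons hk hz (by omega)
      exact ⟨d, h₃, InL.left (w := [(!s, k - 1), c']) (by simpa using h₄)⟩
    · rw [List.cons_append, h10] at hz
      obtain ⟨d, h₃, h₄⟩ := hz.desubst_cons_concat hk (by simp; omega)
      exact ⟨d, h₃, InL.left (w := [(s, 0)]) h₄⟩
  · rw [h10] at h₁
    obtain ⟨p, -, h₃⟩ := InL.desubst_concat (p := []) hk (by simp) h₁ (by simp; omega)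
    exact h₃.right
  · rw [hk1] at hb
    obtain ⟨p, c', -, -, h₃⟩ := InL.desubst_xiW (p := []) hk (by simp) hb (by omega)
    exact InL.left (w := [c']) h₃.right

theorem bispecialShape {k : ℕ} (hk : 4 ≤ k) {w : List Letter} (hw : w ≠ [])
    (hl : LSpecial k w) (hr : RSpecial k w) : BispecialShape k w := by
  induction hN : w.length using Nat.strong_induction_on generalizing w with
  | _ N ih =>
  subst hN
  obtain ⟨t, q, hq⟩ := hl.exists_eq_cons hk hw
  by_cases hB : ∃ z : Letter, z.2 = 1 ∧ InL k (w ++ [z])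
  · obtain ⟨⟨s, i⟩, hi, hz⟩ := hB
    simp only at hi
    subst hi
    obtain ⟨w, l, rfl⟩ := w.eq_nil_or_concat'.resolve_left hw
    obtain rfl : l = (s, 0) := InL.eq_pred (p := w) (y := (s, 1)) hk (by simpa using hz) (by simp)
    rcases w with _ | ⟨a, w⟩
    · refine ⟨s, 0, Or.inl ⟨rfl, fun z hz => ?_⟩⟩
      rcases eq_or_of_inL_concat_zero hk hz with h | h
      · exact Or.inl h
      · exact Or.inr ⟨by omega, by omega, by rw [h, lam_iterate_lt s (by omega)]⟩
    · obtain ⟨v, hv, h₁, h₂, h₃⟩ :=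
        exists_xiW_eq_of_concat_one hk ⟨t, w, by simp at hq; simp [hq.1]⟩ hl hr hz
      have hlen := length_le_length_xiW k v
      rw [hv] at hlen
      have hv0 : v ≠ [] := by
        rintro rfl
        simp at hv
      have hshape := ih v.length (by simp at hlen ⊢; omega) hv0 h₁
        ⟨(s, 0), (!s, k - 1), by simp, h₂, h₃⟩ rfl
      rcases hshape.eq_of_extensions hk h₂ h₃ with rfl | rfl
      · refine ⟨!s, k, Or.inl ⟨?_, fun z hz => ?_⟩⟩
        · have := zeroPow_add_k hk (!s) 0
          rw [zero_add, zero_add] at this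
          rw [this, ← hv, ← zeroPow_succ', show k - 2 + 1 = k - 1 by omega]
          simp [zeroPow]
        · rcases eq_or_of_inL_concat_zero hk hz with h | h
          · exact Or.inl h
          · refine Or.inr ⟨by omega, by omega, ?_⟩
            rw [h, Nat.add_comm, lam_iterate_add_k hk, lam_iterate_lt _ (by omega)]
            simp
      · rw [← zeroPow_two_mul_sub_one hk] at hv
        rw [← hv, ← pairPow_zero]
        refine ⟨s, 0, Or.inr ⟨rfl, fun z hz => Or.inl ⟨by omega, ?_⟩⟩⟩
        have hz' := hz
        rw [pairPow_zero] at hz'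
        rcases eq_or_of_inL_concat_zero hk hz' with h | h
        · left
          obtain ⟨r, i⟩ := z
          simp only at h
          subst h
          by_contra hrs
          have : r = !s := by cases r <;> cases s <;> simp_all
          subst this
          exact not_inL_pairPow_zero_concat hk s hz
        · exact Or.inr h
  · have hA : ∀ z, InL k (w ++ [z]) → z.2 ≠ 1 := fun z hz h => hB ⟨z, h, hz⟩
    obtain ⟨a, b, hab, ha, hb⟩ := hr
    obtain ⟨p, v, c, -, rfl, -, -⟩ := InL.desubst (p := []) (w := w) (z := a) hk (by simp) ha
      (by simp [hq]) (hA a ha)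
    have hR : ∀ z, InL k (xiW k v ++ [z]) → ∃ c, hd k c = z ∧ InL k (v ++ [c]) := by
      intro z hz
      obtain ⟨p, c, -, h₁, h₂⟩ := InL.desubst_xiW (p := []) hk (by simp) hz (hA z hz)
      exact ⟨c, h₁, h₂.right⟩
    have hlv : LSpecial k v := hl.of_forall fun a ha => by
      obtain ⟨z, hz⟩ := ha.exists_concat
      obtain ⟨d, c, h₁, -, h₂⟩ := InL.desubst_cons hk hz (hA z (InL.right (v := [a]) hz))
      exact ⟨d, h₁, InL.left (w := [c]) h₂⟩
    have hv0 : v ≠ [] := by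
      rintro rfl
      simp at hw
    refine BispecialShape.image hk (ih v.length ?_ hv0 hlv ?_ rfl) hR
    · obtain ⟨s, q, rfl⟩ := hlv.exists_eq_cons hk hv0
      exact length_lt_length_xiW k s q
    · obtain ⟨c, rfl, hc⟩ := hR a ha
      obtain ⟨d, rfl, hd⟩ := hR b hb
      exact ⟨c, d, fun h => hab (by rw [h]), hc, hd⟩

/-! ### Left extensions -/

lemma InL.image_cons {k : ℕ} (hk : 4 ≤ k) {a : Letter} {w : List Letter} (h : InL k (a :: w)) :
    InL k (lam k a :: xiW k w) := by
  obtain ⟨q, hq⟩ := exists_xiL_eq hk a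
  have := h.image
  rw [xiW_cons, hq, List.append_assoc] at this
  exact this.right

lemma InL.iterate_cons {k : ℕ} (hk : 4 ≤ k) {a : Letter} {w : List Letter} (h : InL k (a :: w))
    (n : ℕ) : InL k ((lam k)^[n] a :: (xiW k)^[n] w) := by
  induction n with
  | zero => exact h
  | succ n ih =>
    rw [Function.iterate_succ_apply', Function.iterate_succ_apply']
    exact ih.image_cons hk

lemma exists_zeroPow_k {k : ℕ} (hk : 4 ≤ k) (s : Bool) :
    ∃ q, zeroPow k s k = q ++ [(s, k - 1), (!s, 0)] := by
  obtain ⟨q, hq⟩ := exists_zeroPow_eq_concat hk s (i := k - 1) (by omega)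
  refine ⟨q, ?_⟩
  have := zeroPow_add_k hk s 0
  rw [zero_add, zero_add] at this
  rw [this, hq]
  simp [zeroPow]

lemma inL_zeroPow {k : ℕ} (hk : 4 ≤ k) (s : Bool) (n : ℕ) : InL k (zeroPow k s n) := by
  have h : ∀ n, InL k (zeroPow k false n) := fun n => ⟨n, List.infix_rfl⟩
  cases s with
  | false => exact h n
  | true =>
    obtain ⟨q, hq⟩ := exists_zeroPow_k hk false
    have h' := h k
    rw [hq] at h'
    exact (InL.right (v := q ++ [(false, k - 1)]) (w := [(true, 0)]) (by simpa using h')).iterate n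

lemma inL_pair_zero {k : ℕ} (hk : 4 ≤ k) (s : Bool) {a : Letter} (ha : a.2 < k) :
    InL k [a, (s, 0)] := by
  have h₀ : InL k [(!s, k - 1), (s, 0)] := by
    obtain ⟨q, hq⟩ := exists_zeroPow_k hk (!s)
    have h := inL_zeroPow hk (!s) k
    rw [hq, Bool.not_not] at h
    exact h.right
  have h₁ : ∀ i, InL k [(lam k)^[i] (s, 0), (s, 0)] := by
    intro i
    have h := h₀.iterate_cons hk (i + 1)
    rw [Function.iterate_succ_apply, lam, if_pos rfl, Bool.not_not] at h
    obtain ⟨q, hq⟩ := exists_zeroPow_eq_cons k s (i + 1)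
    rw [zeroPow] at hq
    rw [hq] at h
    exact InL.left (w := q) (by simpa using h)
  obtain ⟨t, i⟩ := a
  by_cases hts : t = s
  · subst hts
    have h := h₁ i
    rw [lam_iterate_lt _ ha] at h
    exact h
  · have h := h₁ (i + k)
    rw [lam_iterate_add_k hk, lam_iterate_lt _ ha] at h
    rwa [show t = !s by cases t <;> cases s <;> simp_all]

lemma inL_cons_zeroPow {k : ℕ} (hk : 4 ≤ k) (s : Bool) (n : ℕ) {a : Letter} (ha : a.2 < k) :
    InL k (a :: zeroPow k s n) := by
  induction n generalizing a with
  | zero => exact inL_pair_zero hk s ha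
  | succ n ih =>
    obtain ⟨b, hb, rfl⟩ : ∃ b : Letter, b.2 < k ∧ lam k b = a := by
      obtain ⟨t, i⟩ := a
      by_cases hi : i = 0
      · exact ⟨(!t, k - 1), by simp; omega, by simp [lam, hi]⟩
      · refine ⟨(t, i - 1), by simp at ha ⊢; omega, ?_⟩
        simp only [lam] at ha ⊢
        rw [if_neg (by omega), Nat.sub_add_cancel (by omega)]
    rw [zeroPow_succ']
    exact (ih hb).image_cons hk

lemma inL_triple_zero {k : ℕ} (hk : 4 ≤ k) (s t : Bool) : InL k [(!s, k - 1), (s, 0), (t, 0)] := by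
  have h := (inL_pair_zero hk t (a := (!s, 0)) (by simp; omega)).iterate k
  rw [show [((!s, 0) : Letter), (t, 0)] = [(!s, 0)] ++ [(t, 0)] from rfl, iterate_xiW_append] at h
  change InL k (zeroPow k (!s) k ++ zeroPow k t k) at h
  obtain ⟨q, hq⟩ := exists_zeroPow_k hk (!s)
  obtain ⟨r, hr⟩ := exists_zeroPow_eq_cons k t k
  rw [hq, hr, Bool.not_not] at h
  exact InL.left (w := r) (InL.right (v := q) (by simpa using h))

lemma eq_of_inL_cons_zeroPow_zero {k j : ℕ} (hk : 4 ≤ k) {s t : Bool} {a : Letter}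
    (hj : ∀ i < j, (lam k)^[i] (s, 0) ≠ (!t, k - 2))
    (h : InL k (a :: zeroPow k s j ++ [(t, 0)])) : a = (lam k)^[j] (!s, k - 1) := by
  obtain ⟨p, hp, h'⟩ := InL.desubst_iterate_zero (p := [a]) (x := []) hk (by simp) hj h
  obtain ⟨d, rfl, rfl⟩ := exists_of_map_eq_singleton hp
  rw [InL.eq_of_zero_zero (x := d) (s := s) (t := t) hk h']

lemma inL_cons_pairPow_zero_iff {k : ℕ} (hk : 4 ≤ k) (s : Bool) (a : Letter) :
    InL k (a :: pairPow k s 0) ↔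
      a = (lam k)^[2 * k - 1] (!s, k - 1) ∨ a = (lam k)^[2 * k - 2] (!s, k - 1) := by
  constructor
  · intro h
    rw [pairPow_zero, zeroPow_two_mul_sub_one hk] at h
    obtain ⟨d, c, rfl, hc, h⟩ := InL.desubst_cons (z := (s, 0)) hk (by simpa using h) (by simp)
    rcases eq_of_hd_zero hc with rfl | rfl
    · left
      rw [eq_of_inL_cons_zeroPow_zero hk (fun i hi => ?_) h, ← Function.iterate_succ_apply' (lam k)]
      · congr 2
        omega
      · rcases lam_iterate_two_k (i := i) hk s (by omega) with h | h | h <;> grind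
    · right
      rw [List.cons_append, zeroPow_concat_eq_iterate hk] at h
      obtain ⟨p, hp, h'⟩ := InL.desubst_iterate (p := [d]) hk (by simp) (by omega) h
      obtain ⟨e, rfl, rfl⟩ := exists_of_map_eq_singleton hp
      rw [eq_of_inL_cons_zeroPow_zero (a := e) (t := !s) hk (fun i hi => ?_) h',
        ← Function.iterate_succ_apply' (lam k), ← Function.iterate_add_apply]
      · congr 2
        omega
      · rw [lam_iterate_lt s (by omega)]
        grind
  · rintro (rfl | rfl)
    · have h := (inL_triple_zero hk s s).iterate_cons hk (2 * k - 1)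
      rw [show [((s, 0) : Letter), (s, 0)] = [(s, 0)] ++ [(s, 0)] from rfl,
        iterate_xiW_append] at h
      change InL k (_ :: (zeroPow k s (2 * k - 1) ++ zeroPow k s (2 * k - 1))) at h
      obtain ⟨q, hq⟩ := exists_zeroPow_eq_cons k s (2 * k - 1)
      nth_rewrite 2 [hq] at h
      rw [pairPow_zero]
      exact InL.left (w := q) (by simpa using h)
    · have h := (inL_triple_zero hk s (!s)).iterate_cons hk (k - 2)
      rw [show [((s, 0) : Letter), (!s, 0)] = [(s, 0)] ++ [(!s, 0)] from rfl,
        iterate_xiW_append] at h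
      obtain ⟨q, hq⟩ := exists_zeroPow_eq_cons k (!s) (k - 2)
      rw [zeroPow] at hq
      rw [hq] at h
      have h' := (InL.left (v := (lam k)^[k - 2] (!s, k - 1) :: (zeroPow k s (k - 2) ++ [(!s, 0)]))
        (w := q) (by simpa [zeroPow] using h)).iterate_cons hk k
      rwa [← pairPow_zero_eq_iterate hk, ← Function.iterate_add_apply,
        show k + (k - 2) = 2 * k - 2 by omega] at h'

lemma exists_of_inL_cons_pairPow_succ {k : ℕ} (hk : 4 ≤ k) {s : Bool} {n : ℕ} {a : Letter}
    (hl : LSpecial k (pairPow k s n)) (h : InL k (a :: pairPow k s (n + 1))) :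
    ∃ d, lam k d = a ∧ InL k (d :: pairPow k s n) := by
  rw [pairPow_succ] at h
  obtain ⟨z, hz⟩ := h.exists_concat
  by_cases hz1 : z.2 = 1
  swap
  · obtain ⟨d, c, h₁, -, h₂⟩ := InL.desubst_cons hk hz hz1
    exact ⟨d, h₁, InL.left (w := [c]) h₂⟩
  exfalso
  obtain ⟨t, i⟩ := z
  simp only at hz1
  subst hz1
  have hlen : (zeroPow k s (2 * k - 2)).length + 2 ≤ (pairPow k s n).length := by
    have h₁ : (zeroPow k s (2 * k - 2)).length < (zeroPow k s (n + (2 * k - 1))).length :=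
      length_zeroPow_strictMono k s (by omega)
    obtain ⟨q, hq⟩ := exists_zeroPow_eq_cons k s n
    rw [pairPow, List.length_append, hq, List.length_cons]
    omega
  have hlen' : ∀ t m, (zeroPow k t m).length = (zeroPow k s m).length := by
    intro t m
    by_cases hts : t = s
    · rw [hts]
    · rw [show t = !s by cases t <;> cases s <;> simp_all, ← map_twin_zeroPow, List.length_map]
  have hne : pairPow k s n ≠ [] := by
    intro h
    simp [h] at hlen
  obtain ⟨v, l, hv⟩ := (pairPow k s n).eq_nil_or_concat'.resolve_left hne
  rw [hv] at hl hz hlen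
  obtain ⟨q, hq⟩ := exists_xiW_concat hk v l
  have hl0 : lam k l = (t, 0) :=
    InL.eq_pred (p := a :: q) (y := (t, 1)) hk (by simpa [hq] using hz) (by simp)
  have hlt : l = (!t, k - 1) := by
    refine lam_injective k (hl0.trans ?_)
    simp [lam]
  subst hlt
  have hvt : xiW k (v ++ [(!t, k - 1)]) ++ [(t, 1)] = xiW k (v ++ [(t, 0)]) := by
    rw [xiW_append, xiW_append, xiW_singleton, xiW_singleton, xiL_zero,
      xiL_eq_single (by simp; omega), hl0]
    simp
  rw [List.cons_append, hvt] at hz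
  obtain ⟨d, -, h₁⟩ := hz.desubst_cons_concat hk (by simp; omega)
  replace h₁ : InL k (v ++ [(t, 0)]) := InL.right (v := [d]) h₁
  have hlv : LSpecial k v := by
    obtain ⟨a, b, hab, ha, hb⟩ := hl
    exact ⟨a, b, hab, InL.left (w := [(!t, k - 1)]) ha, InL.left (w := [(!t, k - 1)]) hb⟩
  have h₂ : InL k (v ++ [(!t, k - 1)]) := by
    obtain ⟨a, b, -, ha, -⟩ := hl
    exact InL.right (v := [a]) ha
  have hmono := length_zeroPow_strictMono k s
  have hv0 : v ≠ [] := by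
    rintro rfl
    simp at hlen
  rcases (bispecialShape hk hv0 hlv ⟨_, _, by simp, h₁, h₂⟩).eq_of_extensions hk h₁ h₂ with rfl | rfl
  · have h₃ := hmono (show k - 2 < 2 * k - 2 by omega)
    simp only [List.length_append, List.length_singleton, hlen'] at hlen h₃
    omega
  · simp only [List.length_append, List.length_singleton, hlen'] at hlen
    omega

lemma inL_cons_pairPow_iff {k : ℕ} (hk : 4 ≤ k) (s : Bool) (n : ℕ) (a : Letter) :
    InL k (a :: pairPow k s n) ↔
      a = (lam k)^[n + (2 * k - 1)] (!s, k - 1) ∨ a = (lam k)^[n + (2 * k - 2)] (!s, k - 1) := by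
  induction n generalizing a with
  | zero => rw [zero_add, zero_add]; exact inL_cons_pairPow_zero_iff hk s a
  | succ n ih =>
    have hl : LSpecial k (pairPow k s n) := by
      refine ⟨_, _, ?_, (ih _).2 (Or.inl rfl), (ih _).2 (Or.inr rfl)⟩
      rw [show n + (2 * k - 1) = n + (2 * k - 2) + 1 by omega, Function.iterate_succ_apply']
      exact lam_ne_self k hk _
    rw [show ∀ m, n + 1 + m = n + m + 1 by intro m; omega,
      show ∀ m, n + 1 + m = n + m + 1 by intro m; omega, Function.iterate_succ_apply',
      Function.iterate_succ_apply']
    constructor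
    · intro h
      obtain ⟨d, rfl, hd⟩ := exists_of_inL_cons_pairPow_succ hk hl h
      exact ((ih d).1 hd).imp (congrArg _) (congrArg _)
    · rw [pairPow_succ]
      rintro (rfl | rfl)
      · exact ((ih _).2 (Or.inl rfl)).image_cons hk
      · exact ((ih _).2 (Or.inr rfl)).image_cons hk

/-- for `k ≥ 4`, every nonempty bispecial factor of `u_k` is, up to the
twin map, `ξ^n(0)` or `ξ^{n+2k−1}(0)ξ^n(0)`; moreover `Lext(ξ^n(0)) = A` and
`ξ^{n+2k−1}(0)ξ^n(0)` has exactly `2` left extensions. -/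
theorem stmt_6 (k : ℕ) (hk : 4 ≤ k) (u : ℕ → Letter) (hu : IsFixedPoint k u) :
    (∀ w : List Letter, FactorOf w u → w ≠ [] → Bispecial w u →
      ∃ n : ℕ, w = xiPow k n ∨ w.map twin = xiPow k n ∨
        w = xiPow k (n + 2 * k - 1) ++ xiPow k n ∨
        w.map twin = xiPow k (n + 2 * k - 1) ++ xiPow k n) ∧
    (∀ n : ℕ, Lext (xiPow k n) u = {a : Letter | a.2 < k}) ∧
    (∀ n : ℕ, (Lext (xiPow k (n + 2 * k - 1) ++ xiPow k n) u).ncard = 2) := by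
  have hpair : ∀ n, xiPow k (n + 2 * k - 1) ++ xiPow k n = pairPow k false n := fun n => by
    rw [Nat.add_sub_assoc (by omega)]
    rfl
  refine ⟨?_, fun n => ?_, fun n => ?_⟩
  · rintro w - hw ⟨hl, hr⟩
    simp only [LeftSpecial, RightSpecial, factorOf_iff hu] at hl hr
    obtain ⟨s, n, h⟩ := bispecialShape hk hw hl hr
    refine ⟨n, ?_⟩
    rw [hpair, xiPow_eq]
    rcases h with ⟨rfl, -⟩ | ⟨rfl, -⟩ <;> cases s <;>
      simp [pairPow, map_twin_zeroPow]
  · ext a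
    simp only [Lext, Set.mem_ofPred_eq, factorOf_iff hu]
    exact ⟨fun h => h.snd_lt hk (by simp), fun h => inL_cons_zeroPow hk false n h⟩
  · have hset : Lext (pairPow k false n) u =
        {(lam k)^[n + (2 * k - 2) + 1] (true, k - 1), (lam k)^[n + (2 * k - 2)] (true, k - 1)} := by
      ext a
      simp only [Lext, Set.mem_ofPred_eq, factorOf_iff hu, inL_cons_pairPow_iff hk,
        Set.mem_insert_iff, Set.mem_singleton_iff, Bool.not_false]
      rw [show n + (2 * k - 1) = n + (2 * k - 2) + 1 by omega]
    rw [hpair, hset, Set.ncard_pair]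
    rw [Function.iterate_succ_apply']
    exact lam_ne_self k hk _
end
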